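/- Let k be a positive integer with k ≡ 3 (mod 4). Then the restriction map π_{1+i} : J_{k,2}(O_K) → J_{k,4}, (π_{1+i}φ)(τ,z) = φ(τ,(1+i)z,(1-i)z), is an isomorphism of ℂ-vector spaces. -/

import Mathlib

noncomputable section

open Complex

/-- `τ` lies in the upper half plane. -/
def UHP (τ : ℂ) : Prop := 0 < τ.im

/-- `eC w = exp(2 π i w)`. -/
def eC (w : ℂ) : ℂ := Complex.exp (2 * (Real.pi : ℂ) * Complex.I * w)

/-- Entries of a matrix in `SL(2, ℤ)`, as complex numbers. -/
def Ma (M : Matrix.SpecialLinearGroup (Fin 2) ℤ) : ℂ := ((M.1 0 0 : ℤ) : ℂ)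
def Mb (M : Matrix.SpecialLinearGroup (Fin 2) ℤ) : ℂ := ((M.1 0 1 : ℤ) : ℂ)
def Mc (M : Matrix.SpecialLinearGroup (Fin 2) ℤ) : ℂ := ((M.1 1 0 : ℤ) : ℂ)
def Md (M : Matrix.SpecialLinearGroup (Fin 2) ℤ) : ℂ := ((M.1 1 1 : ℤ) : ℂ)

/-- Hermitian Jacobi form of weight `k` and index `m` for the Hermitian Jacobi group over
`ℤ[i]`.  A form is a function `φ : ℂ → ℂ → ℂ → ℂ`, all conditions being imposed for `τ`
in the upper half plane.  Units `ε ∈ ℤ[i]ˣ = {1, -1, i, -i}`, and the elliptic variables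
`λ = p + q i`, `μ = u + v i` range over `ℤ[i]`.  The Fourier expansion is indexed by
`n ∈ ℕ` and `r = (a + b i)/2 ∈ O_K^♯ = (i/2)ℤ[i]`, supported on `N(r) ≤ n m`,
i.e. `a² + b² ≤ 4 n m`. -/
structure IsHJF (k m : ℕ) (φ : ℂ → ℂ → ℂ → ℂ) : Prop where
  holo : DifferentiableOn ℂ (fun p : ℂ × ℂ × ℂ => φ p.1 p.2.1 p.2.2) {p | UHP p.1}
  transf : ∀ ε : ℂ, ε ∈ ({1, -1, Complex.I, -Complex.I} : Set ℂ) →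
    ∀ M : Matrix.SpecialLinearGroup (Fin 2) ℤ, ∀ τ z₁ z₂ : ℂ, UHP τ →
      φ ((Ma M * τ + Mb M) / (Mc M * τ + Md M))
        (ε * z₁ / (Mc M * τ + Md M))
        ((starRingEnd ℂ) ε * z₂ / (Mc M * τ + Md M))
      = ε ^ k * (Mc M * τ + Md M) ^ k *
          eC ((m : ℂ) * Mc M * z₁ * z₂ / (Mc M * τ + Md M)) * φ τ z₁ z₂
  ellip : ∀ p q u v : ℤ, ∀ τ z₁ z₂ : ℂ, UHP τ →
      φ τ (z₁ + ((p : ℂ) + (q : ℂ) * Complex.I) * τ + ((u : ℂ) + (v : ℂ) * Complex.I))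
          (z₂ + ((p : ℂ) - (q : ℂ) * Complex.I) * τ + ((u : ℂ) - (v : ℂ) * Complex.I))
      = eC (-(m : ℂ) * (((p : ℂ) ^ 2 + (q : ℂ) ^ 2) * τ
          + ((p : ℂ) - (q : ℂ) * Complex.I) * z₁
          + ((p : ℂ) + (q : ℂ) * Complex.I) * z₂)) * φ τ z₁ z₂
  fourier : ∃ c : ℕ → ℤ → ℤ → ℂ,
      (∀ (n : ℕ) (a b : ℤ), 4 * (n : ℤ) * m < a ^ 2 + b ^ 2 → c n a b = 0) ∧
      ∀ τ z₁ z₂ : ℂ, UHP τ →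
        HasSum (fun p : ℕ × ℤ × ℤ => c p.1 p.2.1 p.2.2 *
          eC ((p.1 : ℂ) * τ + (((p.2.1 : ℂ) + (p.2.2 : ℂ) * Complex.I) / 2) * z₁
            + (((p.2.1 : ℂ) - (p.2.2 : ℂ) * Complex.I) / 2) * z₂)) (φ τ z₁ z₂)

/-- Classical Jacobi form of weight `k` and index `m` for `SL(2,ℤ) ⋉ ℤ²`. -/
structure IsJF (k m : ℕ) (φ : ℂ → ℂ → ℂ) : Prop where
  holo : DifferentiableOn ℂ (fun p : ℂ × ℂ => φ p.1 p.2) {p | UHP p.1}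
  transf : ∀ M : Matrix.SpecialLinearGroup (Fin 2) ℤ, ∀ τ z : ℂ, UHP τ →
      φ ((Ma M * τ + Mb M) / (Mc M * τ + Md M)) (z / (Mc M * τ + Md M))
      = (Mc M * τ + Md M) ^ k *
          eC ((m : ℂ) * Mc M * z ^ 2 / (Mc M * τ + Md M)) * φ τ z
  ellip : ∀ p q : ℤ, ∀ τ z : ℂ, UHP τ →
      φ τ (z + (p : ℂ) * τ + (q : ℂ))
      = eC (-(m : ℂ) * ((p : ℂ) ^ 2 * τ + 2 * (p : ℂ) * z)) * φ τ z
  fourier : ∃ c : ℕ → ℤ → ℂ,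
      (∀ (n : ℕ) (r : ℤ), 4 * (n : ℤ) * m < r ^ 2 → c n r = 0) ∧
      ∀ τ z : ℂ, UHP τ →
        HasSum (fun p : ℕ × ℤ => c p.1 p.2 * eC ((p.1 : ℂ) * τ + (p.2 : ℂ) * z)) (φ τ z)

/-- Modular form of weight `k` for `SL(2,ℤ)`. -/
structure IsMF (k : ℕ) (f : ℂ → ℂ) : Prop where
  holo : DifferentiableOn ℂ f {τ | UHP τ}
  transf : ∀ M : Matrix.SpecialLinearGroup (Fin 2) ℤ, ∀ τ : ℂ, UHP τ →
      f ((Ma M * τ + Mb M) / (Mc M * τ + Md M)) = (Mc M * τ + Md M) ^ k * f τ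
  bounded : ∃ A B : ℝ, ∀ τ : ℂ, B ≤ τ.im → ‖f τ‖ ≤ A

/-- Cusp form of weight `k` for `SL(2,ℤ)`. -/
structure IsCF (k : ℕ) (f : ℂ → ℂ) : Prop where
  holo : DifferentiableOn ℂ f {τ | UHP τ}
  transf : ∀ M : Matrix.SpecialLinearGroup (Fin 2) ℤ, ∀ τ : ℂ, UHP τ →
      f ((Ma M * τ + Mb M) / (Mc M * τ + Md M)) = (Mc M * τ + Md M) ^ k * f τ
  decay : ∀ ε : ℝ, 0 < ε → ∃ B : ℝ, ∀ τ : ℂ, B ≤ τ.im → ‖f τ‖ ≤ ε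

/-- `M_w(SL(2,ℤ), ω̄)` for the character `ω` of `SL(2,ℤ)` with `ω(T) = ω(S) = i`:
holomorphic functions on the upper half plane, bounded at infinity, with
`f|_w T = -i f` and `f|_w S = -i f`. -/
structure IsMFOmegaBar (w : ℕ) (f : ℂ → ℂ) : Prop where
  holo : DifferentiableOn ℂ f {τ | UHP τ}
  transT : ∀ τ : ℂ, UHP τ → f (τ + 1) = -Complex.I * f τ
  transS : ∀ τ : ℂ, UHP τ → f (-1 / τ) = -Complex.I * τ ^ w * f τ
  bounded : ∃ A B : ℝ, ∀ τ : ℂ, B ≤ τ.im → ‖f τ‖ ≤ A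

/-- Hermitian theta function `θ^H_{m,s}` of index `m` with characteristic
`s = (a + b i)/2 ∈ O_K^♯`; the sum is over `r = s + m (g₁ + g₂ i) ∈ s + m ℤ[i]`. -/
def thetaH (m : ℕ) (a b : ℤ) (τ z₁ z₂ : ℂ) : ℂ :=
  ∑' g : ℤ × ℤ,
    eC ((((a : ℂ) + 2 * m * g.1) ^ 2 + ((b : ℂ) + 2 * m * g.2) ^ 2) / (4 * m) * τ
      + (((a : ℂ) + 2 * m * g.1) + ((b : ℂ) + 2 * m * g.2) * Complex.I) / 2 * z₁
      + (((a : ℂ) + 2 * m * g.1) - ((b : ℂ) + 2 * m * g.2) * Complex.I) / 2 * z₂)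

/-- Classical theta function `θ_{m,μ}(τ,z) = Σ_{r ≡ μ mod 2m} e(r²τ/(4m) + r z)`. -/
def thetaJ (m : ℕ) (μ : ℤ) (τ z : ℂ) : ℂ :=
  ∑' g : ℤ, eC (((μ : ℂ) + 2 * m * g) ^ 2 / (4 * m) * τ + ((μ : ℂ) + 2 * m * g) * z)

/-- `h` is the family of theta components of `φ` (for index `m`): the `h_{a,b}` depend
only on `(a, b) mod 2m` and `φ = Σ_{s ∈ O_K^♯ / m O_K} h_s θ^H_{m,s}`. -/
def HasThetaDecomp (m : ℕ) (φ : ℂ → ℂ → ℂ → ℂ) (h : ℤ → ℤ → ℂ → ℂ) : Prop :=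
  (∀ (a b : ℤ) (τ : ℂ), h (a + 2 * m) b τ = h a b τ ∧ h a (b + 2 * m) τ = h a b τ) ∧
  ∀ τ z₁ z₂ : ℂ, UHP τ →
    φ τ z₁ z₂ = ∑ a ∈ Finset.range (2 * m), ∑ b ∈ Finset.range (2 * m),
      h (a : ℤ) (b : ℤ) τ * thetaH m (a : ℤ) (b : ℤ) τ z₁ z₂

/-- `ϑ₀(τ) = Σ_{r ∈ ℤ} e(r² τ)`. -/
def theta0C (τ : ℂ) : ℂ := ∑' r : ℤ, eC ((r : ℂ) ^ 2 * τ)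

/-- `ϑ₁(τ) = Σ_{r odd} e(r² τ / 4)`. -/
def theta1C (τ : ℂ) : ℂ := ∑' r : ℤ, eC ((2 * (r : ℂ) + 1) ^ 2 * τ / 4)

/-- `ξ = ϑ₁ ϑ₀' − ϑ₀ ϑ₁'`. -/
def xiC (τ : ℂ) : ℂ := theta1C τ * deriv theta0C τ - theta0C τ * deriv theta1C τ

/-- Taylor coefficient `χ_{α,β}(τ)` of `φ(τ, z₁, z₂)` around `z₁ = z₂ = 0`. -/
def chiHJF (φ : ℂ → ℂ → ℂ → ℂ) (α β : ℕ) (τ : ℂ) : ℂ :=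
  (1 / ((α.factorial : ℂ) * (β.factorial : ℂ))) *
    iteratedDeriv α (fun z₁ => iteratedDeriv β (fun z₂ => φ τ z₁ z₂) 0) 0

/-- `D₀ : J_{k,m} → M_k`, `ψ ↦ ψ(·, 0)`. -/
def D0J (ψ : ℂ → ℂ → ℂ) : ℂ → ℂ := fun τ => ψ τ 0

/-- `D₂ : J_{k,m} → S_{k+2}`, `D₂ψ = (2k/(2πi)²) ψ₂ − (2m/(2πi)) ψ₀'`, where `ψ_ν` are
the Taylor coefficients of `ψ` around `z = 0`. -/
def D2J (k m : ℕ) (ψ : ℂ → ℂ → ℂ) : ℂ → ℂ := fun τ =>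
  (2 * (k : ℂ) / (2 * (Real.pi : ℂ) * Complex.I) ^ 2) *
      ((1 / 2) * iteratedDeriv 2 (fun z => ψ τ z) 0)
    - (2 * (m : ℂ) / (2 * (Real.pi : ℂ) * Complex.I)) * deriv (fun t => ψ t 0) τ

/-- Normalized Eisenstein series `E₄`. -/
def E4C (τ : ℂ) : ℂ :=
  1 + 240 * ∑' n : ℕ, ((ArithmeticFunction.sigma 3) n : ℂ) * eC ((n : ℂ) * τ)

/-- Normalized Eisenstein series `E₆`. -/
def E6C (τ : ℂ) : ℂ :=
  1 - 504 * ∑' n : ℕ, ((ArithmeticFunction.sigma 5) n : ℂ) * eC ((n : ℂ) * τ)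

/-- `f` agrees on the upper half plane with a polynomial in `E₄` and `E₆²` that is
homogeneous of weight `k - v`, i.e. supported on `4a + 12b + v = k`. -/
def IsE4E6sqPoly (v k : ℕ) (f : ℂ → ℂ) : Prop :=
  ∃ lam : ℕ × ℕ → ℂ, ∀ τ : ℂ, UHP τ →
    f τ = ∑ p ∈ (Finset.range (k + 1) ×ˢ Finset.range (k + 1)).filter
        (fun p => 4 * p.1 + 12 * p.2 + v = k),
      lam p * E4C τ ^ p.1 * E6C τ ^ (2 * p.2)

/-- The slash action `φ|_{k,m} M` of `M ∈ SL(2,ℤ)` on functions `ℂ → ℂ → ℂ → ℂ`. -/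
def slashHJF (k m : ℕ) (φ : ℂ → ℂ → ℂ → ℂ) (M : Matrix.SpecialLinearGroup (Fin 2) ℤ)
    (τ z₁ z₂ : ℂ) : ℂ :=
  ((Mc M * τ + Md M) ^ k)⁻¹ *
    eC (-(m : ℂ) * Mc M * z₁ * z₂ / (Mc M * τ + Md M)) *
    φ ((Ma M * τ + Mb M) / (Mc M * τ + Md M)) (z₁ / (Mc M * τ + Md M)) (z₂ / (Mc M * τ + Md M))

/-- Hermitian Jacobi form of weight `k` and index `m` for the congruence subgroup `Γ₀(N)`,
with at each cusp a Fourier expansion supported on `(n, r) ∈ ℚ_{≥0} × O_K^♯`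
with `N(r) ≤ n m`. -/
structure IsHJFLevel (k m N : ℕ) (φ : ℂ → ℂ → ℂ → ℂ) : Prop where
  holo : DifferentiableOn ℂ (fun p : ℂ × ℂ × ℂ => φ p.1 p.2.1 p.2.2) {p | UHP p.1}
  transf : ∀ ε : ℂ, ε ∈ ({1, -1, Complex.I, -Complex.I} : Set ℂ) →
    ∀ M : Matrix.SpecialLinearGroup (Fin 2) ℤ, (N : ℤ) ∣ M.1 1 0 →
    ∀ τ z₁ z₂ : ℂ, UHP τ →
      φ ((Ma M * τ + Mb M) / (Mc M * τ + Md M))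
        (ε * z₁ / (Mc M * τ + Md M))
        ((starRingEnd ℂ) ε * z₂ / (Mc M * τ + Md M))
      = ε ^ k * (Mc M * τ + Md M) ^ k *
          eC ((m : ℂ) * Mc M * z₁ * z₂ / (Mc M * τ + Md M)) * φ τ z₁ z₂
  ellip : ∀ p q u v : ℤ, ∀ τ z₁ z₂ : ℂ, UHP τ →
      φ τ (z₁ + ((p : ℂ) + (q : ℂ) * Complex.I) * τ + ((u : ℂ) + (v : ℂ) * Complex.I))
          (z₂ + ((p : ℂ) - (q : ℂ) * Complex.I) * τ + ((u : ℂ) - (v : ℂ) * Complex.I))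
      = eC (-(m : ℂ) * (((p : ℂ) ^ 2 + (q : ℂ) ^ 2) * τ
          + ((p : ℂ) - (q : ℂ) * Complex.I) * z₁
          + ((p : ℂ) + (q : ℂ) * Complex.I) * z₂)) * φ τ z₁ z₂
  cusp : ∀ M : Matrix.SpecialLinearGroup (Fin 2) ℤ,
      ∃ c : ℚ → ℤ → ℤ → ℂ,
        (∀ (n : ℚ) (a b : ℤ),
          ¬ (0 ≤ n ∧ ((a : ℚ) ^ 2 + (b : ℚ) ^ 2) ≤ 4 * n * m) → c n a b = 0) ∧
        ∀ τ z₁ z₂ : ℂ, UHP τ →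
          HasSum (fun p : ℚ × ℤ × ℤ => c p.1 p.2.1 p.2.2 *
            eC ((p.1 : ℂ) * τ + (((p.2.1 : ℂ) + (p.2.2 : ℂ) * Complex.I) / 2) * z₁
              + (((p.2.1 : ℂ) - (p.2.2 : ℂ) * Complex.I) / 2) * z₂))
            (slashHJF k m φ M τ z₁ z₂)

/-- Theta constant `x`. -/
def thConstX (τ : ℂ) : ℂ := ∑' n : ℤ, eC ((n : ℂ) ^ 2 * τ / 2)

/-- Theta constant `y`. -/
def thConstY (τ : ℂ) : ℂ := ∑' n : ℤ, (-1 : ℂ) ^ n * eC ((n : ℂ) ^ 2 * τ / 2)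

/-- Theta constant `z`. -/
def thConstZ (τ : ℂ) : ℂ := ∑' n : ℤ, eC (((n : ℂ) + 1 / 2) ^ 2 * τ / 2)

lemma eC_add (a b : ℂ) : eC (a + b) = eC a * eC b := by
  unfold eC; rw [← Complex.exp_add]; ring_nf
lemma eC_zero : eC 0 = 1 := by simp [eC]
lemma eC_ne (a : ℂ) : eC a ≠ 0 := Complex.exp_ne_zero _
lemma eC_int (n : ℤ) : eC n = 1 := by
  unfold eC; rw [Complex.exp_eq_one_iff]; exact ⟨n, by ring⟩
lemma eC_nat (n : ℕ) : eC n = 1 := by exact_mod_cast eC_int n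
lemma eC_one : eC 1 = 1 := by simpa using eC_int 1
lemma eC_half : eC (1/2) = -1 := by
  unfold eC; rw [← Complex.exp_pi_mul_I]; congr 1; ring
lemma eC_neg (a : ℂ) : eC (-a) = (eC a)⁻¹ := by
  unfold eC; rw [← Complex.exp_neg]; ring_nf
lemma eC_natmul (n : ℕ) (a : ℂ) : eC (n * a) = eC a ^ n := by
  unfold eC; rw [← Complex.exp_nat_mul]; ring_nf
lemma eC_norm (a : ℂ) : ‖eC a‖ = Real.exp (-2 * Real.pi * a.im) := by
  unfold eC; rw [Complex.norm_exp]; congr 1; simp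
lemma eC_cont : Continuous eC := by unfold eC; fun_prop
lemma eC_diff : Differentiable ℂ eC := by unfold eC; fun_prop
/-- combine: if arguments differ by an integer. -/
lemma eC_congr_int {a b : ℂ} (n : ℤ) (h : a = b + n) : eC a = eC b := by
  rw [h, eC_add, eC_int, mul_one]

lemma int_eC (n : ℤ) : ∫ x in (0:ℝ)..1, eC (n * x) = if n = 0 then 1 else 0 := by
  split_ifs with h
  · subst h; simp [eC_zero]
  · have h2 : (2 * (Real.pi : ℂ) * I * n) ≠ 0 := by
      simp [Real.pi_ne_zero, h]
    have := integral_exp_mul_complex (a := 0) (b := 1) h2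
    have e : ∀ x : ℝ, eC (n * x) = Complex.exp (2 * (Real.pi : ℂ) * I * n * x) := by
      intro x; unfold eC; ring_nf
    simp_rw [e]; rw [this]
    have : Complex.exp (2 * (Real.pi : ℂ) * I * n * (1:ℝ)) = 1 := by
      have := eC_int n; unfold eC at this; simpa using this
    rw [this]; simp

lemma fourier_coeff1 (F : ℤ → ℂ) (g : ℝ → ℂ)
    (hF : ∀ x : ℝ, HasSum (fun a : ℤ => F a * eC (a * x)) (g x)) (b : ℤ) :
    F b = ∫ x in (0:ℝ)..1, g x * eC (-(b * x)) := by
  have hs : Summable (fun a => ‖F a‖) := by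
    have := (hF 0).summable.norm
    simpa [eC_zero] using this
  have nr : ∀ (n : ℤ) (x : ℝ), ‖eC (n * x)‖ = 1 := by
    intro n x; rw [eC_norm]; simp
  let f : ℤ → C(ℝ, ℂ) := fun a => ⟨fun x => F a * eC ((a - b : ℤ) * x), by
    have := eC_cont; fun_prop⟩
  have hk := intervalIntegral.hasSum_intervalIntegral_of_summable_norm (a := 0) (b := 1) (f := f) (by
    refine Summable.of_nonneg_of_le (fun _ => norm_nonneg _) (fun a => ?_) hs
    rw [ContinuousMap.norm_le _ (norm_nonneg _)]
    intro x
    show ‖F a * eC ((a - b : ℤ) * (x:ℝ))‖ ≤ _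
    rw [norm_mul, nr, mul_one])
  have e1 : ∀ a : ℤ, (∫ x in (0:ℝ)..1, f a x) = if a = b then F b else 0 := by
    intro a
    show (∫ x in (0:ℝ)..1, F a * eC ((a - b : ℤ) * x)) = _
    rw [intervalIntegral.integral_const_mul, int_eC]
    by_cases h : a = b
    · simp [h]
    · simp [h, sub_ne_zero.2 h]
  have e2 : ∀ x : ℝ, ∑' a, f a x = g x * eC (-(b * x)) := by
    intro x
    rw [← ((hF x).mul_right (eC (-(b * x)))).tsum_eq]
    congr 1; ext a
    show F a * eC ((a - b : ℤ) * x) = _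
    rw [mul_assoc, ← eC_add]; congr 2; push_cast; ring
  simp_rw [e1, e2] at hk
  have := hk.unique (hasSum_ite_eq b (F b))
  rw [this]

lemma fourier_unique1 (F : ℤ → ℂ)
    (hF : ∀ x : ℝ, HasSum (fun a : ℤ => F a * eC (a * x)) 0) : ∀ b, F b = 0 := by
  intro b; rw [fourier_coeff1 F _ hF b]; simp

lemma fourier_unique1' (F F' : ℤ → ℂ) (g : ℝ → ℂ)
    (hF : ∀ x : ℝ, HasSum (fun a : ℤ => F a * eC (a * x)) (g x))
    (hF' : ∀ x : ℝ, HasSum (fun a : ℤ => F' a * eC (a * x)) (g x)) : ∀ b, F b = F' b := by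
  intro b; rw [fourier_coeff1 F _ hF b, fourier_coeff1 F' _ hF' b]

lemma int_shift (k : ℂ → ℂ) (hk : Differentiable ℂ k) (hp : ∀ z, k (z + 1) = k z) (w : ℂ) :
    ∫ x in (0:ℝ)..1, k (x + w) = ∫ x in (0:ℝ)..1, k x := by
  have h := Complex.integral_boundary_rect_eq_zero_of_differentiableOn k (w.re : ℂ)
    (w + 1) hk.differentiableOn
  simp only [ofReal_re, ofReal_im, add_re, one_re, add_im, one_im, add_zero] at h
  have e : ∀ y : ℝ, k (((w.re + 1 : ℝ) : ℂ) + y * I) = k (w.re + y * I) := by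
    intro y; rw [← hp (w.re + y * I)]; congr 1; push_cast; ring
  simp_rw [e] at h
  have h' : (∫ x in w.re..(w.re+1), k (x + (0:ℝ) * I)) = ∫ x in w.re..(w.re+1), k (x + w.im * I) := by
    linear_combination h
  have p : Function.Periodic (fun x : ℝ => k x) 1 := by
    intro x; show k ((x + 1 : ℝ)) = k x; rw [← hp x]; push_cast; ring_nf
  have h3 := p.intervalIntegral_add_eq w.re 0
  simp only [zero_add] at h3
  rw [← h3]
  have h4 : (∫ x in w.re..(w.re+1), k (x : ℂ)) = ∫ x in w.re..(w.re+1), k (x + w.im * I) := by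
    rw [← h']; simp
  rw [h4]
  have := intervalIntegral.integral_comp_add_right (fun x : ℝ => k (x + w.im * I)) w.re (a := 0) (b := 1)
  rw [zero_add, add_comm 1] at this
  rw [← this]
  congr 1; ext x; congr 1; conv_lhs => rw [← Complex.re_add_im w]
  push_cast; ring

lemma fourier_line (g : ℂ → ℂ) (hg : Differentiable ℂ g) (hp : ∀ z, g (z + 1) = g z)
    (u : ℂ)
    (hs : Summable (fun a : ℤ => (∫ x in (0:ℝ)..1, g x * eC (-(a * x))) * eC (a * u))) :
    HasSum (fun a : ℤ => (∫ x in (0:ℝ)..1, g x * eC (-(a * x))) * eC (a * u)) (g u) := by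
  have per : Function.Periodic (fun x : ℝ => g (x + u)) 1 := by
    intro x; show g ((x + 1 : ℝ) + u) = g (x + u); rw [← hp (x + u)]; push_cast; ring_nf
  let G : C(AddCircle (1:ℝ), ℂ) := ⟨per.lift, by
    refine continuous_coinduced_dom.mpr ?_
    have := hg.continuous
    show Continuous (fun x : ℝ => g (x + u))
    fun_prop⟩
  have e : ∀ a : ℤ, fourierCoeff G a = (∫ x in (0:ℝ)..1, g x * eC (-(a * x))) * eC (a * u) := by
    intro a
    rw [fourierCoeff_eq_intervalIntegral G a 0]
    simp only [zero_add, one_div, inv_one, one_smul]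
    have h1 := int_shift (fun z => g z * eC (-(a * z))) (by
      have := eC_diff; fun_prop) (by
      intro z; rw [hp]; congr 1
      exact eC_congr_int (-a) (by push_cast; ring)) u
    rw [← h1, ← intervalIntegral.integral_mul_const]
    congr 1; ext x
    have : (G : AddCircle (1:ℝ) → ℂ) x = g (x + u) := rfl
    rw [this, smul_eq_mul, fourier_coe_apply, mul_comm, mul_assoc (g (x + u)), ← eC_add]
    congr 1
    unfold eC; congr 1; push_cast; ring
  have := has_pointwise_sum_fourier_series_of_summable (f := G) (by
    rwa [show fourierCoeff G = _ from funext e]) ((0:ℝ) : AddCircle (1:ℝ))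
  simp_rw [e] at this
  have hG : (G : AddCircle (1:ℝ) → ℂ) ((0:ℝ) : AddCircle (1:ℝ)) = g u := by
    show g ((0:ℝ) + u) = _; simp
  rw [hG] at this
  simpa using this

lemma summable_ee {τ : ℂ} (hτ : UHP τ) (u : ℂ) :
    Summable (fun a : ℤ => ‖eC ((a:ℂ)^2 * τ / 8 + a * u)‖) := by
  have h := (summable_jacobiTheta₂_term_iff u (τ / 4)).2 (by
    have : (τ/4).im = τ.im / 4 := by
      rw [show τ / 4 = τ / (4:ℝ) by norm_num, Complex.div_ofReal_im]
    rw [this]; unfold UHP at hτ; positivity)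
  refine h.norm.congr (fun a => ?_)
  unfold jacobiTheta₂_term eC; congr 2; ring

lemma per_mul (h : ℤ → ℂ) (hp : ∀ a, h (a + 4) = h a) (a n : ℤ) : h (a + 4 * n) = h a := by
  induction n using Int.induction_on with
  | zero => simp
  | succ n ih => rw [← ih, ← hp (a + 4 * n)]; ring_nf
  | pred n ih => rw [← ih, ← hp]; ring_nf

lemma per_mod (h : ℤ → ℂ) (hp : ∀ a, h (a + 4) = h a) (a : ℤ) : h a = h (a % 4) := by
  conv_lhs => rw [← Int.emod_add_mul_ediv a 4]
  exact per_mul h hp _ _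

lemma per_bdd (h : ℤ → ℂ) (hp : ∀ a, h (a + 4) = h a) : ∃ K : ℝ, 0 ≤ K ∧ ∀ a, ‖h a‖ ≤ K := by
  refine ⟨‖h 0‖ + ‖h 1‖ + ‖h 2‖ + ‖h 3‖, by positivity, fun a => ?_⟩
  rw [per_mod h hp a]
  have h1 : 0 ≤ a % 4 := Int.emod_nonneg _ (by norm_num)
  have h2 : a % 4 < 4 := Int.emod_lt_of_pos _ (by norm_num)
  have n0 := norm_nonneg (h 0)
  have n1 := norm_nonneg (h 1)
  have n2 := norm_nonneg (h 2)
  have n3 := norm_nonneg (h 3)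
  generalize a % 4 = r at *
  interval_cases r <;> linarith

def cf (τ : ℂ) (g : ℂ → ℂ) (a : ℤ) : ℂ :=
  eC (-((a:ℂ)^2 * τ / 8)) * ∫ x in (0:ℝ)..1, g x * eC (-(a * x))

lemma cf_per {τ : ℂ} {g : ℂ → ℂ} (hg : Differentiable ℂ g) (hp : ∀ z, g (z + 1) = g z)
    (hq : ∀ z, g (z + τ) = eC (-(2 * τ + 4 * z)) * g z) (a : ℤ) : cf τ g (a + 4) = cf τ g a := by
  unfold cf
  have h1 := int_shift (fun z => g z * eC (-(a * z))) (by
      have := eC_diff; fun_prop) (by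
      intro z; rw [hp]; congr 1
      exact eC_congr_int (-a) (by push_cast; ring)) τ
  rw [← h1, ← intervalIntegral.integral_const_mul, ← intervalIntegral.integral_const_mul]
  congr 1; ext x
  rw [hq]
  have e : eC (-(((a + 4 : ℤ):ℂ)^2 * τ / 8)) * eC (-((a + 4 : ℤ) * x))
      = eC (-((a:ℂ)^2 * τ / 8)) * (eC (-(2 * τ + 4 * x)) * eC (-(a * (x + τ)))) := by
    rw [← eC_add, ← eC_add, ← eC_add]; congr 1; push_cast; ring
  linear_combination g x * e

lemma cf_hasSum {τ : ℂ} (hτ : UHP τ) {g : ℂ → ℂ} (hg : Differentiable ℂ g)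
    (hp : ∀ z, g (z + 1) = g z)
    (hq : ∀ z, g (z + τ) = eC (-(2 * τ + 4 * z)) * g z) (u : ℂ) :
    HasSum (fun a : ℤ => cf τ g a * eC ((a:ℂ)^2 * τ / 8 + a * u)) (g u) := by
  have e : ∀ a : ℤ, (∫ x in (0:ℝ)..1, g x * eC (-(a * x))) * eC (a * u)
      = cf τ g a * eC ((a:ℂ)^2 * τ / 8 + a * u) := by
    intro a
    unfold cf
    have : eC (-((a:ℂ)^2 * τ / 8)) * eC ((a:ℂ)^2 * τ / 8 + a * u) = eC (a * u) := by
      rw [← eC_add]; congr 1; ring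
    rw [← this]; ring
  have := fourier_line g hg hp u
  simp_rw [e] at this
  apply this
  obtain ⟨K, hK, hb⟩ := per_bdd _ (cf_per hg hp hq)
  refine Summable.of_norm_bounded ((summable_ee hτ u).mul_left K) (fun a => ?_)
  rw [norm_mul]; gcongr; exact hb a

structure QP (τ : ℂ) (f : ℂ → ℂ → ℂ) : Prop where
  diff : Differentiable ℂ (fun p : ℂ × ℂ => f p.1 p.2)
  per : ∀ u v, f (u + 1) v = f u v
  quasi : ∀ u v, f (u + τ) v = eC (-(2 * τ + 4 * u)) * f u v
  rot : ∀ u v, f v (-u) = -I * f u v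

def Tm (τ : ℂ) (h : ℤ → ℤ → ℂ) (u v : ℂ) (p : ℤ × ℤ) : ℂ :=
  h p.1 p.2 * eC (((p.1:ℂ)^2 + (p.2:ℂ)^2) * τ / 8 + p.1 * u + p.2 * v)

lemma eC_split (τ u v : ℂ) (a b : ℤ) : eC (((a:ℂ)^2 + (b:ℂ)^2) * τ / 8 + a * u + b * v)
    = eC ((a:ℂ)^2 * τ / 8 + a * u) * eC ((b:ℂ)^2 * τ / 8 + b * v) := by
  rw [← eC_add]; congr 1; ring

lemma per2_bdd (h : ℤ → ℤ → ℂ) (h1 : ∀ a b, h (a + 4) b = h a b)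
    (h2 : ∀ a b, h a (b + 4) = h a b) : ∃ K : ℝ, 0 ≤ K ∧ ∀ a b, ‖h a b‖ ≤ K := by
  have : ∀ a, ∃ K : ℝ, 0 ≤ K ∧ ∀ b, ‖h a b‖ ≤ K := fun a => per_bdd _ (h2 a)
  choose K hK hb using this
  refine ⟨K 0 + K 1 + K 2 + K 3, ?_, fun a b => ?_⟩
  · have := hK 0; have := hK 1; have := hK 2; have := hK 3; linarith
  · rw [per_mod (fun a => h a b) (fun a => h1 a b) a]
    have e1 : 0 ≤ a % 4 := Int.emod_nonneg _ (by norm_num)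
    have e2 : a % 4 < 4 := Int.emod_lt_of_pos _ (by norm_num)
    have n0 := hK 0
    have n1 := hK 1
    have n2 := hK 2
    have n3 := hK 3
    generalize a % 4 = r at *
    have := hb r b
    interval_cases r <;> linarith

lemma Tm_summable {τ : ℂ} (hτ : UHP τ) (h : ℤ → ℤ → ℂ) (h1 : ∀ a b, h (a + 4) b = h a b)
    (h2 : ∀ a b, h a (b + 4) = h a b) (u v : ℂ) : Summable (Tm τ h u v) := by
  obtain ⟨K, hK, hb⟩ := per2_bdd h h1 h2
  have := (summable_ee hτ u).mul_of_nonneg (summable_ee hτ v) (fun _ => norm_nonneg _)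
    (fun _ => norm_nonneg _)
  refine Summable.of_norm_bounded (this.mul_left K) (fun p => ?_)
  unfold Tm
  rw [eC_split, norm_mul, norm_mul]
  gcongr; exact hb _ _

lemma param_diff (f : ℂ → ℂ → ℂ) (hf : Differentiable ℂ (fun p : ℂ × ℂ => f p.1 p.2)) (a : ℤ) :
    Differentiable ℂ (fun v => ∫ x in (0:ℝ)..1, f x v * eC (-(a * x))) := by
  intro v0
  let F : ℂ → ℝ → ℂ := fun v x => f x v * eC (-(a * x))
  have hc : Continuous (fun p : ℂ × ℝ => F p.1 p.2) := by
    have := hf.continuous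
    have e := eC_cont
    show Continuous (fun p : ℂ × ℝ => f p.2 p.1 * eC (-(a * p.2)))
    have h1 : Continuous (fun p : ℂ × ℝ => f p.2 p.1) :=
      this.comp (g := fun p : ℂ × ℂ => f p.1 p.2) (f := fun p : ℂ × ℝ => ((p.2 : ℂ), p.1)) (by fun_prop)
    fun_prop
  have hd : ∀ x : ℝ, Differentiable ℂ (fun v => F v x) := by
    intro x
    have : Differentiable ℂ (fun v => f x v) :=
      hf.comp (f := fun v : ℂ => ((x:ℂ), v)) (by fun_prop)
    show Differentiable ℂ (fun v => f x v * eC (-(a * x)))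
    fun_prop
  have hcomp : IsCompact (Metric.closedBall v0 2 ×ˢ Set.Icc (0:ℝ) 1) :=
    (isCompact_closedBall _ _).prod isCompact_Icc
  obtain ⟨C, hC⟩ := hcomp.exists_bound_of_continuousOn hc.continuousOn
  have := intervalIntegral.hasDerivAt_integral_of_dominated_loc_of_deriv_le (μ := MeasureTheory.volume)
    (a := 0) (b := 1)
    (F := F) (F' := fun v x => deriv (fun v => F v x) v) (x₀ := v0) (s := Metric.ball v0 1)
    (bound := fun _ => C)
    (Metric.ball_mem_nhds _ one_pos)
    (Filter.Eventually.of_forall fun v => by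
      have : Continuous (F v) := hc.comp (f := fun x : ℝ => (v, x)) (by fun_prop)
      exact this.aestronglyMeasurable)
    (by
      have : Continuous (F v0) := hc.comp (f := fun x : ℝ => (v0, x)) (by fun_prop)
      exact this.intervalIntegrable _ _)
    (by
      have h3 : Continuous (Function.uncurry (fun (x : ℝ) (v : ℂ) => F v x)) :=
        hc.comp (f := fun p : ℝ × ℂ => (p.2, p.1)) (by fun_prop)
      have h4 := stronglyMeasurable_deriv_with_param h3
      have h5 : MeasureTheory.StronglyMeasurable (fun x : ℝ => deriv (fun v => F v x) v0) :=
        h4.comp_measurable (g := fun x : ℝ => (x, v0)) (by fun_prop)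
      exact h5.aestronglyMeasurable)
    (Filter.Eventually.of_forall fun x hx v hv => by
      have hx' : x ∈ Set.Icc (0:ℝ) 1 := by
        rw [Set.uIoc_of_le zero_le_one] at hx; exact ⟨hx.1.le, hx.2⟩
      have := Complex.norm_deriv_le_of_forall_mem_sphere_norm_le (c := v) (R := 1) (C := C)
        (f := fun v => F v x) one_pos (hd x).diffContOnCl (by
          intro z hz
          refine hC (z, x) ⟨?_, hx'⟩
          rw [Metric.mem_closedBall]; rw [mem_sphere_iff_norm] at hz; rw [Metric.mem_ball] at hv
          calc dist z v0 ≤ dist z v + dist v v0 := dist_triangle _ _ _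
            _ ≤ 2 := by rw [dist_eq_norm, hz]; linarith)
      simpa using this)
    (by simp)
    (Filter.Eventually.of_forall fun x _ v _ => (hd x v).hasDerivAt)
  exact this.2.differentiableAt

lemma QP_expand {τ : ℂ} (hτ : UHP τ) {f : ℂ → ℂ → ℂ} (hf : QP τ f) :
    ∃ h : ℤ → ℤ → ℂ, (∀ a b, h (a + 4) b = h a b) ∧ (∀ a b, h a (b + 4) = h a b) ∧
      ∀ u v, HasSum (Tm τ h u v) (f u v) := by
  have hrot : ∀ u v, f u v = I * f v (-u) := by
    intro u v; rw [hf.rot]; linear_combination (f u v) * I_sq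
  have per2 : ∀ u v, f u (v + 1) = f u v := by
    intro u v; rw [hrot, hf.per, ← hrot]
  have q2 : ∀ u v, f u (v + τ) = eC (-(2 * τ + 4 * v)) * f u v := by
    intro u v; rw [hrot, hf.quasi, hrot u v]; ring
  have d1 : ∀ v, Differentiable ℂ (fun u => f u v) := fun v =>
    hf.diff.comp (f := fun u : ℂ => (u, v)) (by fun_prop)
  let H : ℤ → ℂ → ℂ := fun a v => cf τ (fun u => f u v) a
  have Hd : ∀ a, Differentiable ℂ (H a) := fun a => by
    show Differentiable ℂ (fun v => _ * _)
    exact (param_diff f hf.diff a).const_mul _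
  have Hp : ∀ a v, H a (v + 1) = H a v := fun a v => by
    show cf _ _ _ = cf _ _ _
    simp_rw [per2]
  have Hq : ∀ a v, H a (v + τ) = eC (-(2 * τ + 4 * v)) * H a v := fun a v => by
    show cf _ _ _ = _ * cf _ _ _
    simp_rw [q2]
    unfold cf
    simp_rw [mul_assoc]
    rw [intervalIntegral.integral_const_mul]; ring
  have Hper : ∀ a, H (a + 4) = H a := fun a => by
    ext v; exact cf_per (d1 v) (fun z => hf.per z v) (fun z => hf.quasi z v) a
  have h1 : ∀ a b, cf τ (H (a+4)) b = cf τ (H a) b := fun a b => by rw [Hper]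
  have h2 : ∀ a b, cf τ (H a) (b + 4) = cf τ (H a) b := fun a b => cf_per (Hd a) (Hp a) (Hq a) b
  refine ⟨fun a b => cf τ (H a) b, h1, h2, fun u v => ?_⟩
  have hs := Tm_summable hτ _ h1 h2 u v
  have a1 := hs.hasSum.prod_fiberwise (g := fun a : ℤ => H a v * eC ((a:ℂ)^2 * τ / 8 + a * u)) (fun a => by
    have := (cf_hasSum hτ (Hd a) (Hp a) (Hq a) v).mul_right (eC ((a:ℂ)^2 * τ / 8 + a * u))
    refine this.congr_fun ?_ 
    intro b
    unfold Tm; rw [eC_split]; ring)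
  have a2 := cf_hasSum hτ (d1 v) (fun z => hf.per z v) (fun z => hf.quasi z v) u
  have := a1.unique a2
  rw [← this]; exact hs.hasSum

lemma jt_hasSum (z : ℂ) {τ : ℂ} (hτ : UHP τ) :
    HasSum (fun n : ℤ => eC ((n:ℂ)^2 * τ / 2 + n * z)) (jacobiTheta₂ z τ) := by
  refine (hasSum_jacobiTheta₂_term z hτ).congr_fun (fun n => ?_)
  unfold jacobiTheta₂_term eC; congr 1; ring

lemma tsum_split (N : ℕ) [NeZero N] (f : ℤ → ℂ) (hs : Summable f) :
    ∑' a, f a = ∑ j : Fin N, ∑' n : ℤ, f (n * N + (j : ℕ)) := by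
  rw [← (Int.divModEquiv N).symm.tsum_eq f]
  have hs' : Summable (fun p : ℤ × Fin N => f ((Int.divModEquiv N).symm p)) :=
    (Int.divModEquiv N).symm.summable_iff.2 hs
  have hs2 : Summable (fun p : Fin N × ℤ => f ((Int.divModEquiv N).symm (p.2, p.1))) :=
    (Equiv.prodComm (Fin N) ℤ).summable_iff.2 hs'
  have := (Equiv.prodComm (Fin N) ℤ).tsum_eq (fun p : ℤ × Fin N => f ((Int.divModEquiv N).symm p))
  rw [← this]
  refine (Summable.tsum_prod hs2).trans ?_
  rw [tsum_fintype]
  rfl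

lemma UHP_half {τ : ℂ} (hτ : UHP τ) : UHP (τ / 2) := by
  unfold UHP at *
  have : (τ/2).im = τ.im / 2 := by
    rw [show τ / 2 = τ / (2:ℝ) by norm_num, Complex.div_ofReal_im]
  rw [this]; positivity

lemma jt_not_zero {τ : ℂ} (hτ : UHP τ) : ¬ ∀ x, jacobiTheta₂ x τ = 0 := by
  intro h
  have := fourier_unique1 (fun n => eC ((n:ℂ)^2 * τ / 2)) (fun x => by
    rw [← h x]
    refine (jt_hasSum x hτ).congr_fun (fun n => ?_)
    rw [← eC_add]) 0
  exact eC_ne _ this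

lemma landen {τ : ℂ} (hτ : UHP τ) (h0 : jacobiTheta₂ (1/2) τ = 0) (x : ℂ) :
    jacobiTheta₂ x (τ/2) * jacobiTheta₂ (x + 1/2) (τ/2) = 0 := by
  have H1 := jt_hasSum x (UHP_half hτ)
  have H2 := jt_hasSum (x + 1/2) (UHP_half hτ)
  rw [← H1.tsum_eq, ← H2.tsum_eq, tsum_mul_tsum_of_summable_norm H1.summable.norm H2.summable.norm]
  have hs := summable_mul_of_summable_norm H1.summable.norm H2.summable.norm
  let e : ℤ × ℤ ≃ ℤ × ℤ :=
    { toFun := fun p => (p.2, p.1 - p.2)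
      invFun := fun p => (p.1 + p.2, p.1)
      left_inv := fun p => by ext <;> simp
      right_inv := fun p => by ext <;> simp }
  have hs' : Summable (fun p => (fun z : ℤ × ℤ => eC ((z.1:ℂ)^2 * (τ/2) / 2 + z.1 * x) *
      eC ((z.2:ℂ)^2 * (τ/2) / 2 + z.2 * (x + 1/2))) (e p)) := e.summable_iff.2 hs
  rw [← e.tsum_eq]
  refine (Summable.tsum_prod hs').trans ?_
  have : ∀ s : ℤ, ∑' m : ℤ, (fun z : ℤ × ℤ => eC ((z.1:ℂ)^2 * (τ/2) / 2 + z.1 * x) *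
      eC ((z.2:ℂ)^2 * (τ/2) / 2 + z.2 * (x + 1/2))) (e (s, m)) = 0 := by
    intro s
    have E : ∀ m : ℤ, e (s, m) = (m, s - m) := fun m => rfl
    simp_rw [E]
    rcases Int.even_or_odd' s with ⟨S, rfl | rfl⟩
    · rw [← (Equiv.addLeft S).tsum_eq]
      have t : ∀ D : ℤ, eC (((Equiv.addLeft S D : ℤ):ℂ)^2 * (τ/2) / 2 + (Equiv.addLeft S D : ℤ) * x) *
          eC (((2 * S - (Equiv.addLeft S D) : ℤ):ℂ)^2 * (τ/2) / 2 + (2 * S - (Equiv.addLeft S D) : ℤ) * (x + 1/2))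
          = eC ((S:ℂ)^2 * τ / 2 + S * (2 * x + 1/2)) * eC ((D:ℂ)^2 * τ / 2 + D * (1/2)) := by
        intro D
        rw [← eC_add, ← eC_add]
        refine eC_congr_int (-D) ?_
        simp only [Equiv.coe_addLeft]; push_cast; ring
      simp_rw [t]
      rw [tsum_mul_left, (jt_hasSum (1/2) hτ).tsum_eq, h0, mul_zero]
    · have t := (Equiv.subLeft (2 * S + 1)).tsum_eq (fun m : ℤ => eC ((m:ℂ)^2 * (τ/2) / 2 + m * x) *
          eC (((2 * S + 1 - m : ℤ):ℂ)^2 * (τ/2) / 2 + (2 * S + 1 - m : ℤ) * (x + 1/2)))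
      have t2 : ∀ m : ℤ, eC (((Equiv.subLeft (2 * S + 1) m : ℤ):ℂ)^2 * (τ/2) / 2 + (Equiv.subLeft (2 * S + 1) m : ℤ) * x) *
          eC (((2 * S + 1 - (Equiv.subLeft (2 * S + 1) m) : ℤ):ℂ)^2 * (τ/2) / 2 + (2 * S + 1 - (Equiv.subLeft (2 * S + 1) m) : ℤ) * (x + 1/2))
          = - (eC ((m:ℂ)^2 * (τ/2) / 2 + m * x) *
          eC (((2 * S + 1 - m : ℤ):ℂ)^2 * (τ/2) / 2 + (2 * S + 1 - m : ℤ) * (x + 1/2))) := by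
        intro m
        rw [← eC_add, ← eC_add, neg_eq_neg_one_mul, ← eC_half, ← eC_add]
        refine eC_congr_int (m - S - 1) ?_
        simp only [Equiv.subLeft_apply]; push_cast; ring
      simp_rw [t2] at t
      rw [tsum_neg] at t
      exact self_eq_neg.1 t.symm
  simp_rw [this]; exact tsum_zero

lemma jt_half_ne {τ : ℂ} (hτ : UHP τ) : jacobiTheta₂ (1/2) τ ≠ 0 := by
  intro h0
  have hd : Differentiable ℂ (fun x => jacobiTheta₂ x (τ/2)) := fun x =>
    differentiableAt_jacobiTheta₂_fst x (UHP_half hτ)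
  have hd2 : Differentiable ℂ (fun x => jacobiTheta₂ (x + 1/2) (τ/2)) :=
    hd.comp (f := fun x : ℂ => x + 1/2) (by fun_prop)
  rcases AnalyticOnNhd.eq_zero_or_eq_zero_of_mul_eq_zero (U := Set.univ)
    (hd.differentiableOn.analyticOnNhd isOpen_univ) (hd2.differentiableOn.analyticOnNhd isOpen_univ)
    (fun x _ => landen hτ h0 x) isPreconnected_univ with h | h
  · exact jt_not_zero (UHP_half hτ) (fun x => h x trivial)
  · refine jt_not_zero (UHP_half hτ) (fun x => ?_)
    have := h (x - 1/2) trivial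
    simpa using this

lemma jt_tau_half_ne {τ : ℂ} (hτ : UHP τ) : jacobiTheta₂ (τ/2) τ ≠ 0 := by
  have h0 : τ ≠ 0 := by rintro rfl; simp [UHP] at hτ
  rw [jacobiTheta₂_functional_equation]
  have h2 : UHP (-1/τ) := by
    unfold UHP at *
    rw [neg_div, one_div, ← inv_neg, Complex.inv_im]
    simp only [neg_im, neg_neg]
    have : 0 < normSq τ := normSq_pos.2 h0
    rw [Complex.normSq_neg]; positivity
  have : τ / 2 / τ = 1/2 := by field_simp
  rw [this]
  refine mul_ne_zero (mul_ne_zero ?_ (Complex.exp_ne_zero _)) (jt_half_ne h2)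
  rw [one_div]
  apply inv_ne_zero
  rw [Complex.cpow_ne_zero_iff]
  left; simp [h0]

def tx (w : ℂ) : ℂ := ∑' n : ℤ, w ^ (4 * n^2 + n).toNat
def ty (w : ℂ) : ℂ := ∑' n : ℤ, w ^ (4 * n^2 + 3 * n).toNat
def td (w : ℂ) : ℂ := ∑' n : ℤ, (-1)^n.natAbs * w ^ (n^2).toNat

lemma nx (n : ℤ) : 0 ≤ 4 * n^2 + n := by
  rcases lt_trichotomy n 0 with h | h | h <;> nlinarith
lemma ny (n : ℤ) : 0 ≤ 4 * n^2 + 3 * n := by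
  rcases lt_trichotomy n 0 with h | h | h <;> nlinarith

lemma eC_pow_toNat (τ : ℂ) {k : ℤ} (hk : 0 ≤ k) : eC τ ^ k.toNat = eC (k * τ) := by
  rw [← eC_natmul]; congr 2; exact_mod_cast Int.toNat_of_nonneg hk

lemma UHP_mul {τ : ℂ} (hτ : UHP τ) (n : ℕ) (hn : 0 < n) : UHP (n * τ) := by
  unfold UHP at *; simp; exact mul_pos (by exact_mod_cast hn) hτ

lemma tx_hasSum {τ : ℂ} (hτ : UHP τ) :
    HasSum (fun n : ℤ => eC ((4 * (n:ℂ)^2 + n) * τ)) (tx (eC τ)) := by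
  have := jt_hasSum τ (UHP_mul hτ 8 (by norm_num))
  have e : ∀ n : ℤ, eC τ ^ (4 * n^2 + n).toNat = eC ((4 * (n:ℂ)^2 + n) * τ) := fun n => by
    rw [eC_pow_toNat _ (nx n)]; push_cast; rfl
  unfold tx; simp_rw [e]
  apply Summable.hasSum
  refine this.summable.congr (fun n => ?_)
  congr 1; push_cast; ring

lemma ty_hasSum {τ : ℂ} (hτ : UHP τ) :
    HasSum (fun n : ℤ => eC ((4 * (n:ℂ)^2 + 3 * n) * τ)) (ty (eC τ)) := by
  have := jt_hasSum (3 * τ) (UHP_mul hτ 8 (by norm_num))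
  have e : ∀ n : ℤ, eC τ ^ (4 * n^2 + 3 * n).toNat = eC ((4 * (n:ℂ)^2 + 3 * n) * τ) := fun n => by
    rw [eC_pow_toNat _ (ny n)]; push_cast; rfl
  unfold ty; simp_rw [e]
  apply Summable.hasSum
  refine this.summable.congr (fun n => ?_)
  congr 1; push_cast; ring

lemma eC_half_mul (n : ℤ) : eC (n * (1/2)) = (-1)^n.natAbs := by
  have h := n.natAbs_eq
  generalize n.natAbs = m at h ⊢
  rw [← eC_half, ← eC_natmul]
  rcases h with rfl | rfl
  · simp
  · refine eC_congr_int (-m) ?_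
    push_cast; ring

lemma td_hasSum {τ : ℂ} (hτ : UHP τ) :
    HasSum (fun n : ℤ => (-1)^n.natAbs * eC ((n:ℂ)^2 * τ)) (td (eC τ)) := by
  have := jt_hasSum (1/2) (UHP_mul hτ 2 (by norm_num))
  have e : ∀ n : ℤ, eC τ ^ (n^2).toNat = eC ((n:ℂ)^2 * τ) := fun n => by
    rw [eC_pow_toNat _ (sq_nonneg n)]; push_cast; rfl
  unfold td; simp_rw [e]
  apply Summable.hasSum
  refine this.summable.congr (fun n => ?_)
  rw [← eC_half_mul, ← eC_add]
  congr 1; push_cast; ring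

lemma td_ne {τ : ℂ} (hτ : UHP τ) : td (eC τ) ≠ 0 := by
  have h1 := jt_hasSum (1/2) (UHP_mul hτ 2 (by norm_num))
  have h2 := td_hasSum hτ
  have : td (eC τ) = jacobiTheta₂ (1/2) ((2:ℕ) * τ) := by
    refine h2.unique (h1.congr_fun fun n => ?_)
    rw [← eC_half_mul, ← eC_add]
    congr 1; push_cast; ring
  rw [this]; exact jt_half_ne (UHP_mul hτ 2 (by norm_num))

/-- `x + s y` as theta value, `s = ±e(τ/2)` given by `ε = 0, 1`. -/
lemma xy_eq {τ : ℂ} (hτ : UHP τ) (ε : ℕ) :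
    tx (eC τ) + (-1)^ε * eC (τ/2) * ty (eC τ) = jacobiTheta₂ (τ/2 + ε/2) ((2:ℕ) * τ) := by
  have h := jt_hasSum (τ/2 + ε/2) (UHP_mul hτ 2 (by norm_num))
  rw [← h.tsum_eq, tsum_split 2 _ h.summable, Fin.sum_univ_two]
  congr 1
  · rw [← (tx_hasSum hτ).tsum_eq]
    congr 1; ext n
    refine (eC_congr_int (ε * n) ?_).symm
    push_cast; simp; ring
  · rw [← (ty_hasSum hτ).tsum_eq, ← tsum_mul_left]
    rw [← (Equiv.subLeft (-1 : ℤ)).tsum_eq]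
    congr 1; ext n
    rw [← eC_half, ← eC_natmul, ← eC_add, ← eC_add]
    refine (eC_congr_int (-(ε * n)) ?_)
    simp only [Equiv.subLeft_apply]
    push_cast; simp; ring

lemma xpy_ne {τ : ℂ} (hτ : UHP τ) : jacobiTheta₂ (τ/2) ((2:ℕ) * τ) ≠ 0 := by
  have h := jt_hasSum (τ/2/2) (UHP_half hτ)
  have h2 := jt_hasSum (τ/2) (UHP_mul hτ 2 (by norm_num))
  have : jacobiTheta₂ (τ/2/2) (τ/2) = 2 * jacobiTheta₂ (τ/2) ((2:ℕ) * τ) := by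
    rw [← h.tsum_eq, tsum_split 2 _ h.summable, Fin.sum_univ_two, two_mul]
    congr 1
    · rw [← h2.tsum_eq]; congr 1; ext n; congr 1; push_cast; simp; ring
    · rw [← h2.tsum_eq, ← (Equiv.subLeft (-1 : ℤ)).tsum_eq
        (fun n : ℤ => eC ((n:ℂ)^2 * ((2:ℕ) * τ) / 2 + n * (τ/2)))]
      congr 1; ext n; congr 1; simp only [Equiv.subLeft_apply]; push_cast; simp; ring
  intro h0
  rw [h0, mul_zero] at this
  exact jt_tau_half_ne (UHP_half hτ) this

lemma UHP_add_one {τ : ℂ} (hτ : UHP τ) : UHP (τ + 1) := by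
  unfold UHP at *; simpa using hτ

lemma disc_ne {τ : ℂ} (hτ : UHP τ) : tx (eC τ)^2 - eC τ * ty (eC τ)^2 ≠ 0 := by
  have h0 := xy_eq hτ 0
  have h1 := xy_eq hτ 1
  have e : eC τ = eC (τ/2) * eC (τ/2) := by rw [← eC_add]; congr 1; ring
  have h2 : tx (eC τ)^2 - eC τ * ty (eC τ)^2 = jacobiTheta₂ (τ/2 + (0:ℕ)/2) ((2:ℕ) * τ)
      * jacobiTheta₂ (τ/2 + (1:ℕ)/2) ((2:ℕ) * τ) := by
    rw [← h0, ← h1]; linear_combination (-ty (eC τ)^2) * e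
  rw [h2]
  refine mul_ne_zero ?_ ?_
  · simpa using xpy_ne hτ
  · have := xpy_ne (UHP_add_one hτ)
    have e2 : ((2:ℕ):ℂ) * (τ + 1) = (2:ℕ) * τ + 2 := by push_cast; ring
    rw [e2, jacobiTheta₂_add_right] at this
    convert this using 2
    push_cast; ring

lemma exists_eC {w : ℂ} (hw : ‖w‖ < 1) (h0 : w ≠ 0) : ∃ τ, UHP τ ∧ eC τ = w := by
  have h2 : (2 * (Real.pi : ℂ) * I) ≠ 0 := by simp [Real.pi_ne_zero]
  have e : eC (Complex.log w / (2 * (Real.pi : ℂ) * I)) = w := by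
    unfold eC; rw [mul_div_cancel₀ _ h2, Complex.exp_log h0]
  refine ⟨_, ?_, e⟩
  have := eC_norm (Complex.log w / (2 * (Real.pi : ℂ) * I))
  rw [e] at this
  rw [this, Real.exp_lt_one_iff] at hw
  have := Real.pi_pos
  unfold UHP
  by_contra hc
  push Not at hc
  nlinarith

lemma eC_lt_one {τ : ℂ} (hτ : UHP τ) : ‖eC τ‖ < 1 := by
  rw [eC_norm, Real.exp_lt_one_iff]; unfold UHP at hτ
  have := Real.pi_pos
  nlinarith [mul_pos this hτ]

lemma tx_zero : tx 0 = 1 := by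
  unfold tx
  rw [tsum_eq_single 0]
  · simp
  · intro n hn
    apply zero_pow
    have : 0 < 4 * n^2 + n := by
      rcases lt_trichotomy n 0 with h | h | h
      · nlinarith
      · exact absurd h hn
      · nlinarith
    omega

lemma td_zero : td 0 = 1 := by
  unfold td
  rw [tsum_eq_single 0]
  · simp
  · intro n hn
    have : 0 < n^2 := by positivity
    rw [zero_pow (by omega), mul_zero]

lemma disc_ne' {w : ℂ} (hw : ‖w‖ < 1) : tx w^2 - w * ty w^2 ≠ 0 := by
  by_cases h : w = 0
  · subst h; rw [tx_zero]; simp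
  · obtain ⟨τ, hτ, rfl⟩ := exists_eC hw h
    exact disc_ne hτ

lemma td_ne' {w : ℂ} (hw : ‖w‖ < 1) : td w ≠ 0 := by
  by_cases h : w = 0
  · subst h; rw [td_zero]; simp
  · obtain ⟨τ, hτ, rfl⟩ := exists_eC hw h
    exact td_ne hτ

/-- generic: sum of monomials with bounded coefficients is holomorphic on the disc if absolutely
convergent there. -/
lemma diff_of_pow {ι : Type*} (c : ι → ℂ) (e : ι → ℕ)
    (hs : ∀ w : ℂ, ‖w‖ < 1 → w ≠ 0 → Summable (fun i => c i * w ^ (e i))) :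
    DifferentiableOn ℂ (fun w => ∑' i, c i * w ^ (e i)) (Metric.ball 0 1) := by
  intro w hw
  have hw' : ‖w‖ < 1 := by simpa using hw
  set r : ℝ := (‖w‖ + 1)/2
  have hr0 : 0 < r := by positivity
  have hr1 : r < 1 := by simp only [r]; linarith
  have hrw : ‖w‖ < r := by simp only [r]; linarith
  have hsr := (hs (r:ℂ) (by simpa [abs_of_pos hr0] using hr1) (by simpa using hr0.ne')).norm
  have := differentiableOn_tsum_of_summable_norm (F := fun i w => c i * w ^ (e i)) (U := Metric.ball (0:ℂ) r) hsr
    (fun i => by fun_prop) Metric.isOpen_ball (fun i x hx => by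
      rw [norm_mul, norm_mul, norm_pow, norm_pow]
      have : ‖x‖ < r := by simpa using hx
      gcongr
      simpa [abs_of_pos hr0] using this.le)
  exact (this.differentiableAt (Metric.isOpen_ball.mem_nhds (by simpa using hrw))).differentiableWithinAt

lemma tx_diff : DifferentiableOn ℂ tx (Metric.ball 0 1) := by
  have := diff_of_pow (fun _ : ℤ => 1) (fun n => (4 * n^2 + n).toNat) (fun w hw h0 => by
    obtain ⟨τ, hτ, rfl⟩ := exists_eC hw h0
    refine (tx_hasSum hτ).summable.congr (fun n => ?_)
    rw [eC_pow_toNat _ (nx n)]; push_cast; simp)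
  simp only [one_mul] at this
  exact this

lemma ty_diff : DifferentiableOn ℂ ty (Metric.ball 0 1) := by
  have := diff_of_pow (fun _ : ℤ => 1) (fun n => (4 * n^2 + 3 * n).toNat) (fun w hw h0 => by
    obtain ⟨τ, hτ, rfl⟩ := exists_eC hw h0
    refine (ty_hasSum hτ).summable.congr (fun n => ?_)
    rw [eC_pow_toNat _ (ny n)]; push_cast; simp)
  simp only [one_mul] at this
  exact this

lemma td_diff : DifferentiableOn ℂ td (Metric.ball 0 1) :=
  diff_of_pow (fun n : ℤ => (-1)^n.natAbs) (fun n => (n^2).toNat) (fun w hw h0 => by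
    obtain ⟨τ, hτ, rfl⟩ := exists_eC hw h0
    refine (td_hasSum hτ).summable.congr (fun n => ?_)
    rw [eC_pow_toNat _ (sq_nonneg n)]; push_cast; rfl)

structure HD (h : ℤ → ℤ → ℂ) : Prop where
  h1 : ∀ a b, h (a + 4) b = h a b
  h2 : ∀ a b, h a (b + 4) = h a b
  rot : ∀ a b, h b (-a) = -I * h a b

lemma Tm_unique {τ : ℂ} {h : ℤ → ℤ → ℂ}
    (H : ∀ u v, HasSum (Tm τ h u v) 0) : ∀ a b, h a b = 0 := by
  intro a b
  have h0 : ∀ v : ℂ, ∀ a, ∑' b : ℤ, h a b * eC (((a:ℂ)^2 + (b:ℂ)^2) * τ / 8 + b * v) = 0 := by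
    intro v
    refine fourier_unique1 _ (fun x => ?_)
    refine ((H x v).prod_fiberwise (fun a => ((H x v).summable.prod_factor a).hasSum)).congr_fun (fun a => ?_)
    rw [← tsum_mul_right]
    congr 1; ext b
    unfold Tm
    rw [mul_assoc, ← eC_add]; congr 2; ring
  have h1 : ∀ b, h a b * eC (((a:ℂ)^2 + (b:ℂ)^2) * τ / 8) = 0 := by
    refine fourier_unique1 _ (fun x => ?_)
    rw [← h0 x a]
    have hs := ((H 0 x).summable.prod_factor a)
    refine (hs.congr (fun b => ?_)).hasSum.congr_fun (fun b => ?_)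
    · unfold Tm; congr 2; ring
    · rw [mul_assoc, ← eC_add]
  simpa [eC_ne] using h1 b

lemma Tm_rot (τ : ℂ) (h : ℤ → ℤ → ℂ) {u v s : ℂ} (H : HasSum (Tm τ h v (-u)) s) :
    HasSum (Tm τ (fun a b => h b (-a)) u v) s := by
  let e : ℤ × ℤ ≃ ℤ × ℤ :=
    { toFun := fun p => (p.2, -p.1)
      invFun := fun p => (-p.2, p.1)
      left_inv := fun p => by ext <;> simp
      right_inv := fun p => by ext <;> simp }
  have := e.hasSum_iff.2 H
  refine this.congr_fun (fun p => ?_)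
  show Tm _ _ _ _ _ = Tm τ h v (-u) (p.2, -p.1)
  unfold Tm
  simp only
  congr 2; push_cast; ring

lemma QP_HD {τ : ℂ} {f : ℂ → ℂ → ℂ} (hf : QP τ f) {h : ℤ → ℤ → ℂ}
    (h1 : ∀ a b, h (a + 4) b = h a b) (h2 : ∀ a b, h a (b + 4) = h a b)
    (H : ∀ u v, HasSum (Tm τ h u v) (f u v)) : HD h := by
  refine ⟨h1, h2, fun a b => ?_⟩
  have := Tm_unique (τ := τ) (h := fun a b => h b (-a) + I * h a b) (fun u v => by
    have e1 := Tm_rot τ h (H v (-u))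
    have e2 := (H u v).mul_left I
    have e3 := e1.add e2
    rw [hf.rot] at e3
    have : -I * f u v + I * f u v = 0 := by ring
    rw [this] at e3
    refine e3.congr_fun (fun p => ?_)
    unfold Tm; ring) a b
  linear_combination this

def Tmat (A B D : ℂ) : Matrix (ZMod 4) (ZMod 4) ℂ :=
  show Matrix (Fin 4) (Fin 4) ℂ from
  !![0, I * A, 0, -I * A; A, I * D, -I * B, D; 0, B, 0, -B; -A, -D, I * B, -I * D]

def tab (A B D : ℂ) (a b : ℤ) : ℂ := Tmat A B D (a : ZMod 4) (b : ZMod 4)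

lemma Tmat_rot (A B D : ℂ) (a b : ZMod 4) : Tmat A B D b (-a) = -I * Tmat A B D a b := by
  have hI : I * I = -1 := I_mul_I
  have key : ∀ a b : Fin 4, Tmat A B D b ((fun x : ZMod 4 => -x) a) = -I * Tmat A B D a b := by
    intro a b
    fin_cases a <;> fin_cases b <;> simp [Tmat] <;>
      first | rfl | (ring_nf; simp; done) | (ring_nf; simp; rfl)
  exact key a b

lemma tab_HD (A B D : ℂ) : HD (tab A B D) := by
  have h4 : (4 : ZMod 4) = 0 := rfl
  refine ⟨fun a b => ?_, fun a b => ?_, fun a b => ?_⟩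
  · unfold tab; push_cast; rw [h4, add_zero]
  · unfold tab; push_cast; rw [h4, add_zero]
  · unfold tab; push_cast; exact Tmat_rot _ _ _ _ _

lemma HD.rot2 {h : ℤ → ℤ → ℂ} (H : HD h) (a b : ℤ) : h (-a) (-b) = - h a b := by
  rw [H.rot b (-a), H.rot a b]; linear_combination (h a b) * I_sq

lemma HD.sh {h : ℤ → ℤ → ℂ} (H : HD h) {a b a' b' : ℤ} (e1 : a % 4 = a' % 4) (e2 : b % 4 = b' % 4) :
    h a b = h a' b' := by
  rw [per_mod (fun a => h a b) (fun a => H.h1 a b) a, per_mod (fun a => h a b') (fun a => H.h1 a b') a']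
  rw [e1]
  rw [per_mod (fun b => h (a' % 4) b) (fun b => H.h2 (a' % 4) b) b,
    per_mod (fun b => h (a' % 4) b) (fun b => H.h2 (a' % 4) b) b', e2]

lemma HD.facts {h : ℤ → ℤ → ℂ} (H : HD h) :
    h 0 0 = 0 ∧ h 0 1 = I * h 1 0 ∧ h 0 2 = 0 ∧ h 0 3 = -I * h 1 0 ∧
    h 1 1 = I * h 1 3 ∧ h 1 2 = -I * h 2 1 ∧
    h 2 0 = 0 ∧ h 2 2 = 0 ∧ h 2 3 = - h 2 1 ∧
    h 3 0 = - h 1 0 ∧ h 3 1 = - h 1 3 ∧ h 3 2 = I * h 2 1 ∧ h 3 3 = -I * h 1 3 := by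
  have z : ∀ x : ℂ, x = -x → x = 0 := fun x hx => self_eq_neg.1 hx
  have f30 : h 3 0 = - h 1 0 := by
    rw [← H.rot2]; exact H.sh (by norm_num) (by norm_num)
  have f03 : h 0 3 = -I * h 1 0 := by
    rw [← H.rot]; exact H.sh (by norm_num) (by norm_num)
  have f01 : h 0 1 = I * h 1 0 := by
    have : h 0 1 = - h 0 3 := by
      rw [← H.rot2]; exact H.sh (by norm_num) (by norm_num)
    rw [this, f03]; ring
  have f12 : h 1 2 = -I * h 2 1 := by
    rw [← H.rot]; exact H.sh (by norm_num) (by norm_num)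
  have f32 : h 3 2 = I * h 2 1 := by
    have : h 3 2 = - h 1 2 := by
      rw [← H.rot2]; exact H.sh (by norm_num) (by norm_num)
    rw [this, f12]; ring
  have f33 : h 3 3 = -I * h 1 3 := by
    rw [← H.rot]; exact H.sh (by norm_num) (by norm_num)
  have f11 : h 1 1 = I * h 1 3 := by
    have : h 1 1 = - h 3 3 := by
      rw [← H.rot2]; exact H.sh (by norm_num) (by norm_num)
    rw [this, f33]; ring
  refine ⟨z _ ?_, f01, z _ ?_, f03, f11, f12, z _ ?_, z _ ?_, ?_, f30, ?_, f32, f33⟩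
  all_goals rw [← H.rot2]; exact H.sh (by norm_num) (by norm_num)

lemma HD.zero {h : ℤ → ℤ → ℂ} (H : HD h) (hA : h 1 0 = 0) (hB : h 2 1 = 0) (hD : h 1 3 = 0)
    (a b : ℤ) : h a b = 0 := by
  obtain ⟨f00, f01, f02, f03, f11, f12, f20, f22, f23, f30, f31, f32, f33⟩ := H.facts
  rw [hA] at f01 f03 f30
  rw [hB] at f12 f23 f32
  rw [hD] at f11 f31 f33
  simp only [mul_zero, neg_zero] at *
  rw [H.sh (a' := a % 4) (b' := b % 4) (by simp) (by simp)]
  have h1 : 0 ≤ a % 4 := Int.emod_nonneg _ (by norm_num)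
  have h2 : a % 4 < 4 := Int.emod_lt_of_pos _ (by norm_num)
  have h3 : 0 ≤ b % 4 := Int.emod_nonneg _ (by norm_num)
  have h4 : b % 4 < 4 := Int.emod_lt_of_pos _ (by norm_num)
  generalize a % 4 = r at *
  generalize b % 4 = s at *
  interval_cases r <;> interval_cases s <;> assumption

def Rt (τ : ℂ) (h : ℤ → ℤ → ℂ) (r b : ℤ) : ℂ :=
  h (r + b) b * eC ((((r + b : ℤ):ℂ)^2 + (b:ℂ)^2) * τ / 8)

def Rr (τ : ℂ) (h : ℤ → ℤ → ℂ) (r : ℤ) : ℂ := ∑' b : ℤ, Rt τ h r b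

def shearE : ℤ × ℤ ≃ ℤ × ℤ :=
    { toFun := fun p => (p.1 + p.2, p.2)
      invFun := fun p => (p.1 - p.2, p.2)
      left_inv := fun p => by ext <;> simp
      right_inv := fun p => by ext <;> simp }

lemma shear_summable {τ : ℂ} (hτ : UHP τ) {h : ℤ → ℤ → ℂ} (H : HD h) (r : ℤ) :
    Summable (Rt τ h r) := by
  have := shearE.summable_iff.2 (Tm_summable hτ h H.h1 H.h2 0 0)
  refine (this.prod_factor r).congr (fun b => ?_)
  show Tm τ h 0 0 (r + b, b) = Rt τ h r b
  unfold Rt Tm; simp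

lemma restr_hasSum {τ : ℂ} (hτ : UHP τ) {h : ℤ → ℤ → ℂ} (H : HD h) {z F : ℂ}
    (hF : HasSum (Tm τ h z (-z)) F) : HasSum (fun r : ℤ => Rr τ h r * eC (r * z)) F := by
  have := shearE.hasSum_iff.2 hF
  refine this.prod_fiberwise (fun r => ?_)
  refine ((shear_summable hτ H r).hasSum.mul_right (eC (r * z))).congr_fun (fun b => ?_)
  show Tm τ h z (-z) (r + b, b) = _
  unfold Rt Tm
  rw [mul_assoc, ← eC_add]; congr 2; push_cast; ring

lemma Rr_neg (τ : ℂ) {h : ℤ → ℤ → ℂ} (H : HD h) (r : ℤ) : Rr τ h (-r) = - Rr τ h r := by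
  unfold Rr
  rw [← (Equiv.neg ℤ).tsum_eq, ← tsum_neg]
  congr 1; ext b
  unfold Rt
  simp only [Equiv.neg_apply]
  rw [← neg_add, H.rot2, neg_mul]
  congr 3; push_cast; ring

lemma Rr_shift (τ : ℂ) {h : ℤ → ℤ → ℂ} (H : HD h) (r : ℤ) :
    Rr τ h (r + 8) = eC ((r + 4) * τ) * Rr τ h r := by
  unfold Rr
  rw [← (Equiv.subRight (4:ℤ)).tsum_eq, ← tsum_mul_left]
  congr 1; ext b
  unfold Rt
  simp only [Equiv.subRight_apply]
  rw [H.sh (a' := r + b) (b' := b) (by omega) (by omega), mul_left_comm, ← eC_add]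
  congr 2; push_cast; ring

lemma Dgen {τ : ℂ} (D : ℤ → ℂ) (ho : ∀ r, D (-r) = - D r)
    (hs : ∀ r : ℤ, D (r + 8) = eC ((r + 4) * τ) * D r) (d1 : D 1 = 0) (d2 : D 2 = 0) (d3 : D 3 = 0)
    (r : ℤ) : D r = 0 := by
  have d0 : D 0 = 0 := self_eq_neg.1 (by simpa using ho 0)
  have m1 : D (-1) = 0 := by rw [ho, d1, neg_zero]
  have m2 : D (-2) = 0 := by rw [ho, d2, neg_zero]
  have m3 : D (-3) = 0 := by rw [ho, d3, neg_zero]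
  have d4 : D 4 = 0 := by
    have := hs (-4)
    rw [ho] at this
    norm_num [eC_zero] at this
    exact self_eq_neg.1 this
  have d5 : D 5 = 0 := by have := hs (-3); rw [m3, mul_zero] at this; simpa using this
  have d6 : D 6 = 0 := by have := hs (-2); rw [m2, mul_zero] at this; simpa using this
  have d7 : D 7 = 0 := by have := hs (-1); rw [m1, mul_zero] at this; simpa using this
  have key : ∀ n s : ℤ, D s = 0 → D (s + 8 * n) = 0 := by
    intro n s h0
    induction n using Int.induction_on with
    | zero => simpa using h0
    | succ n ih =>
      have := hs (s + 8 * n)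
      rw [ih, mul_zero] at this
      rw [← this]; congr 1; ring
    | pred n ih =>
      have := hs (s + 8 * (-n - 1))
      rw [show s + 8 * (-n - 1) + 8 = s + 8 * -(n:ℤ) by ring, ih] at this
      rcases mul_eq_zero.1 this.symm with h | h
      · exact absurd h (eC_ne _)
      · exact h
  rw [← Int.emod_add_mul_ediv r 8]
  apply key
  have h1 : 0 ≤ r % 8 := Int.emod_nonneg _ (by norm_num)
  have h2 : r % 8 < 8 := Int.emod_lt_of_pos _ (by norm_num)
  generalize r % 8 = s at *
  interval_cases s <;> assumption

/-- one residue class of the sum. -/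
lemma cls_eq (K : ℂ) (x : ℂ) (q : ℤ → ℂ) (hq : HasSum q x) (e : ℤ ≃ ℤ)
    (C : ℂ) (F : ℤ → ℂ) (hF : ∀ n, F (e n) = C * (eC K * q n)) :
    ∑' n, F n = C * (eC K * x) := by
  rw [← e.tsum_eq, ← hq.tsum_eq, ← tsum_mul_left, ← tsum_mul_left]
  congr 1; ext n; exact hF n


lemma Rr_one {τ : ℂ} (hτ : UHP τ) {h : ℤ → ℤ → ℂ} (H : HD h) :
    Rr τ h 1 = (1 - I) * h 1 0 * (eC (τ/8) * tx (eC τ)) + (1 + I) * h 2 1 * (eC (5*τ/8) * ty (eC τ)) := by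
  obtain ⟨f00, f01, f02, f03, f11, f12, f20, f22, f23, f30, f31, f32, f33⟩ := H.facts
  unfold Rr
  rw [tsum_split 4 _ (shear_summable hτ H 1), Fin.sum_univ_four]
  rw [cls_eq (τ/8) _ _ (tx_hasSum hτ) (Equiv.refl ℤ) (h 1 0),
    cls_eq (5*τ/8) _ _ (ty_hasSum hτ) (Equiv.refl ℤ) (h 2 1),
    cls_eq (5*τ/8) _ _ (ty_hasSum hτ) (Equiv.subLeft (-1)) (h 3 2),
    cls_eq (τ/8) _ _ (tx_hasSum hτ) (Equiv.subLeft (-1)) (h 0 3), f32, f03]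
  · ring
  all_goals
    intro n
    unfold Rt
    rw [← eC_add]
    congr 1
    · exact H.sh (by simp <;> omega) (by simp <;> omega)
    · congr 1; simp; ring

lemma Rr_three {τ : ℂ} (hτ : UHP τ) {h : ℤ → ℤ → ℂ} (H : HD h) :
    Rr τ h 3 = -((1 - I) * h 1 0 * (eC (9*τ/8) * ty (eC τ)) + (1 + I) * h 2 1 * (eC (5*τ/8) * tx (eC τ))) := by
  obtain ⟨f00, f01, f02, f03, f11, f12, f20, f22, f23, f30, f31, f32, f33⟩ := H.facts
  unfold Rr
  rw [tsum_split 4 _ (shear_summable hτ H 3), Fin.sum_univ_four]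
  rw [cls_eq (9*τ/8) _ _ (ty_hasSum hτ) (Equiv.refl ℤ) (h 3 0),
    cls_eq (9*τ/8) _ _ (ty_hasSum hτ) (Equiv.subLeft (-1)) (h 0 1),
    cls_eq (5*τ/8) _ _ (tx_hasSum hτ) (Equiv.subLeft (-1)) (h 1 2),
    cls_eq (5*τ/8) _ _ (tx_hasSum hτ) (Equiv.subRight 1) (h 2 3), f30, f01, f12, f23]
  · ring
  all_goals
    intro n
    unfold Rt
    rw [← eC_add]
    congr 1
    · exact H.sh (by simp <;> omega) (by simp <;> omega)
    · congr 1; simp; ring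

lemma Rr_two {τ : ℂ} (hτ : UHP τ) {h : ℤ → ℤ → ℂ} (H : HD h) :
    Rr τ h 2 = h 1 3 * (eC (τ/4) * td (eC τ)) := by
  obtain ⟨f00, f01, f02, f03, f11, f12, f20, f22, f23, f30, f31, f32, f33⟩ := H.facts
  unfold Rr
  have T := td_hasSum hτ
  have z : HasSum (fun _ : ℤ => (0:ℂ)) 0 := hasSum_zero
  have hs0 : Summable (fun n : ℤ => eC ((2*(n:ℂ))^2*τ)) :=
    (jt_hasSum 0 (UHP_mul hτ 8 (by norm_num))).summable.congr (fun n => by congr 1; push_cast; ring)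
  have hs1 : Summable (fun n : ℤ => eC ((2*(n:ℂ)+1)^2*τ)) := by
    refine ((jt_hasSum (4*τ) (UHP_mul hτ 8 (by norm_num))).summable.mul_left (eC τ)).congr (fun n => ?_)
    rw [← eC_add]; congr 1; push_cast; ring
  have ht : td (eC τ) = ∑' n : ℤ, eC ((2*(n:ℂ))^2*τ) - ∑' n : ℤ, eC ((2*(n:ℂ)+1)^2*τ) := by
    rw [← T.tsum_eq, tsum_split 2 _ T.summable, Fin.sum_univ_two, sub_eq_add_neg, ← tsum_neg]
    congr 1
    · congr 1; ext n
      rw [Even.neg_one_pow (by simp)]; simp; ring_nf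
    · congr 1; ext n
      rw [Odd.neg_one_pow (by rw [Int.natAbs_odd]; exact ⟨n, by simp; ring⟩)]; simp; ring_nf
  obtain ⟨x0, hx0⟩ := hs0
  obtain ⟨x1, hx1⟩ := hs1
  rw [hx0.tsum_eq, hx1.tsum_eq] at ht
  rw [tsum_split 4 _ (shear_summable hτ H 2), Fin.sum_univ_four]
  rw [cls_eq 0 _ _ z (Equiv.refl ℤ) (h 2 0),
    cls_eq (τ/4) _ _ hx1 (Equiv.refl ℤ) (h 3 1),
    cls_eq 0 _ _ z (Equiv.refl ℤ) (h 0 2),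
    cls_eq (τ/4) _ _ hx0 (Equiv.subRight 1) (h 1 3), f31, ht]
  · ring
  · intro n
    unfold Rt
    rw [← eC_add]
    congr 1
    · exact H.sh (by simp <;> omega) (by simp <;> omega)
    · congr 1; simp; ring
  · intro n
    unfold Rt
    rw [H.sh (a' := 0) (b' := 2) (by simp <;> omega) (by simp <;> omega), f02]; simp
  · intro n
    unfold Rt
    rw [← eC_add]
    congr 1
    · exact H.sh (by simp <;> omega) (by simp <;> omega)
    · congr 1; simp; ring
  · intro n
    unfold Rt
    rw [H.sh (a' := 2) (b' := 0) (by simp <;> omega) (by simp <;> omega), f20]; simp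

lemma one_sub_I_ne : (1 - I) ≠ 0 := by
  intro h; have := congrArg Complex.re h; simp at this
lemma one_add_I_ne : (1 + I) ≠ 0 := by
  intro h; have := congrArg Complex.re h; simp at this

/-- restriction to `(z,-z)` is injective. -/
lemma QP_unique {τ : ℂ} (hτ : UHP τ) {f : ℂ → ℂ → ℂ} (hf : QP τ f) (h0 : ∀ z, f z (-z) = 0)
    (u v : ℂ) : f u v = 0 := by
  obtain ⟨h, h1, h2, hh⟩ := QP_expand hτ hf
  have H := QP_HD hf h1 h2 hh
  have R0 := fourier_unique1 (Rr τ h) (fun x => by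
    have := restr_hasSum hτ H (hh x (-x)); rwa [h0] at this)
  have r1 := R0 1
  have r2 := R0 2
  have r3 := R0 3
  rw [Rr_one hτ H] at r1
  rw [Rr_two hτ H] at r2
  rw [Rr_three hτ H] at r3
  have e9 : eC (9*τ/8) = eC (τ/8) * eC τ := by rw [← eC_add]; congr 1; ring
  rw [e9] at r3
  have hD : h 1 3 = 0 := by
    simpa [td_ne hτ, eC_ne (τ/4)] using r2
  have dn := disc_ne hτ
  have hA : h 1 0 = 0 := by
    have : (h 1 0) * ((1 - I) * eC (τ/8) * (tx (eC τ)^2 - eC τ * ty (eC τ)^2)) = 0 := by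
      linear_combination tx (eC τ) * r1 + ty (eC τ) * r3
    rcases mul_eq_zero.1 this with h | h
    · exact h
    · exact absurd h (mul_ne_zero (mul_ne_zero one_sub_I_ne (eC_ne _)) dn)
  have hB : h 2 1 = 0 := by
    have : (h 2 1) * ((1 + I) * eC (5*τ/8) * (tx (eC τ)^2 - eC τ * ty (eC τ)^2)) = 0 := by
      linear_combination (-eC τ * ty (eC τ)) * r1 - tx (eC τ) * r3
    rcases mul_eq_zero.1 this with h | h
    · exact h
    · exact absurd h (mul_ne_zero (mul_ne_zero one_add_I_ne (eC_ne _)) dn)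
  have hz := H.zero hA hB hD
  refine (hh u v).unique ?_
  have : Tm τ h u v = fun _ => 0 := by ext p; unfold Tm; rw [hz, zero_mul]
  rw [this]; exact hasSum_zero

lemma Ik3 {k : ℕ} (hk4 : k % 4 = 3) : I ^ k = -I := by
  rw [show k = 4 * (k / 4) + 3 by omega, pow_add, pow_mul, I_pow_four, one_pow, one_mul, Complex.I_pow_three]

lemma rest_JF (k : ℕ) {φ : ℂ → ℂ → ℂ → ℂ} (H : IsHJF k 2 φ) :
    IsJF k 4 (fun τ z => φ τ ((1 + I) * z) ((1 - I) * z)) := by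
  refine ⟨?_, ?_, ?_, ?_⟩
  · exact H.holo.comp (f := fun p : ℂ × ℂ => (p.1, (1 + I) * p.2, (1 - I) * p.2))
      (by fun_prop) (fun p hp => hp)
  · intro M τ z hτ
    have := H.transf 1 (by simp) M τ ((1 + I) * z) ((1 - I) * z) hτ
    simp only [one_mul, map_one, one_pow] at this
    simp only [mul_div_assoc'] 
    rw [this]
    congr 3
    push_cast
    have : (1 + I) * (1 - I) = 2 := by linear_combination -I_sq
    linear_combination (2 * Mc M * z^2 / (Mc M * τ + Md M)) * this
  · intro p q τ z hτ
    have := H.ellip p p q q τ ((1 + I) * z) ((1 - I) * z) hτ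
    convert this using 2
    · ring
    · ring
    · congr 1
      push_cast
      linear_combination (-4 * p * z) * I_sq
  · obtain ⟨c, hc, hs⟩ := H.fourier
    refine ⟨fun n r => ∑' b : ℤ, c n (r + b) b, ?_, ?_⟩
    · intro n r hr
      have : ∀ b, c n (r + b) b = 0 := fun b => hc n _ _ (by
        push_cast at hr ⊢
        nlinarith [sq_nonneg (r + 2 * b)])
      simp [this]
    · intro τ z hτ
      let e : (ℕ × ℤ) × ℤ ≃ ℕ × ℤ × ℤ :=
        { toFun := fun p => (p.1.1, p.1.2 + p.2, p.2)
          invFun := fun p => ((p.1, p.2.1 - p.2.2), p.2.2)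
          left_inv := fun p => by ext <;> simp
          right_inv := fun p => by ext <;> simp }
      have h1 := e.hasSum_iff.2 (hs τ ((1 + I) * z) ((1 - I) * z) hτ)
      have h2 : HasSum (fun p : (ℕ × ℤ) × ℤ => c p.1.1 (p.1.2 + p.2) p.2 * eC (p.1.1 * τ + p.1.2 * z))
          (φ τ ((1 + I) * z) ((1 - I) * z)) := by
        refine h1.congr_fun (fun p => ?_)
        simp only [e, Function.comp, Equiv.coe_fn_mk]
        congr 2
        push_cast
        linear_combination (-(p.2:ℂ) * z) * I_sq
      refine (h2.prod_fiberwise (fun p => (h2.summable.prod_factor p).hasSum)).congr_fun (fun p => ?_)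
      simp only
      rw [tsum_mul_right]

lemma QP.sub {τ : ℂ} {f g : ℂ → ℂ → ℂ} (hf : QP τ f) (hg : QP τ g) : QP τ (fun u v => f u v - g u v) where
  diff := hf.diff.sub hg.diff
  per u v := by rw [hf.per, hg.per]
  quasi u v := by rw [hf.quasi, hg.quasi]; ring
  rot u v := by rw [hf.rot, hg.rot]; ring

lemma HJF_QP {k : ℕ} (hk4 : k % 4 = 3) {φ : ℂ → ℂ → ℂ → ℂ} (H : IsHJF k 2 φ) {τ : ℂ} (hτ : UHP τ) :
    QP τ (fun u v => φ τ (u - I * v) (u + I * v)) where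
  diff := by
    have := H.holo.comp (s := Set.univ) (f := fun p : ℂ × ℂ => (τ, p.1 - I * p.2, p.1 + I * p.2))
      (by fun_prop) (fun p hp => hτ)
    exact differentiableOn_univ.1 this
  per u v := by
    have := H.ellip 0 0 1 0 τ (u - I * v) (u + I * v) hτ
    simp [eC_zero] at this
    rw [← this]; congr 1 <;> ring
  quasi u v := by
    have := H.ellip 1 0 0 0 τ (u - I * v) (u + I * v) hτ
    simp at this
    convert this using 2
    · ring
    · ring
    · congr 1; ring
  rot u v := by
    have := H.transf I (by simp) 1 τ (u - I * v) (u + I * v) hτ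
    simp [Ma, Mb, Mc, Md, eC_zero, Ik3 hk4] at this
    rw [neg_mul, ← this]; congr 1 <;> linear_combination v * I_sq

lemma part2 {k : ℕ} (hk4 : k % 4 = 3) {φ φ' : ℂ → ℂ → ℂ → ℂ} (H : IsHJF k 2 φ) (H' : IsHJF k 2 φ')
    (h : ∀ τ z : ℂ, UHP τ →
        φ τ ((1 + Complex.I) * z) ((1 - Complex.I) * z)
          = φ' τ ((1 + Complex.I) * z) ((1 - Complex.I) * z)) (τ z₁ z₂ : ℂ) (hτ : UHP τ) :
    φ τ z₁ z₂ = φ' τ z₁ z₂ := by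
  have := QP_unique hτ ((HJF_QP hk4 H hτ).sub (HJF_QP hk4 H' hτ)) (fun z => by
    have := h τ z hτ
    rw [show z - I * -z = (1 + I) * z by ring, show z + I * -z = (1 - I) * z by ring, this, sub_self])
    ((z₁ + z₂)/2) (I * (z₁ - z₂)/2)
  have e1 : (z₁ + z₂)/2 - I * (I * (z₁ - z₂)/2) = z₁ := by linear_combination (-(z₁ - z₂)/2) * I_sq
  have e2 : (z₁ + z₂)/2 + I * (I * (z₁ - z₂)/2) = z₂ := by linear_combination ((z₁ - z₂)/2) * I_sq
  rw [e1, e2] at this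
  exact sub_eq_zero.1 this

def th (r : ℕ) (τ u : ℂ) : ℂ := eC ((r:ℂ)^2 * τ / 8 + r * u) * jacobiTheta₂ (4 * u + r * τ) ((4:ℕ) * τ)

lemma th_diff (r : ℕ) : DifferentiableOn ℂ (fun p : ℂ × ℂ => th r p.1 p.2) {p | UHP p.1} := by
  intro p hp
  apply DifferentiableAt.differentiableWithinAt
  unfold th
  have e := eC_diff
  have h1 : DifferentiableAt ℂ (fun q : ℂ × ℂ => jacobiTheta₂ q.1 q.2) (4 * p.2 + r * p.1, (4:ℕ) * p.1) :=
    (hasFDerivAt_jacobiTheta₂ _ (UHP_mul hp 4 (by norm_num))).differentiableAt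
  have h2 : DifferentiableAt ℂ (fun p : ℂ × ℂ => jacobiTheta₂ (4 * p.2 + r * p.1) ((4:ℕ) * p.1)) p :=
    h1.comp p (f := fun p : ℂ × ℂ => (4 * p.2 + r * p.1, (4:ℕ) * p.1)) (by fun_prop)
  refine DifferentiableAt.mul ?_ h2
  fun_prop

lemma per_sum {τ : ℂ} (hτ : UHP τ) (k : ℤ → ℂ) (hk : ∀ a, k (a + 4) = k a) (u : ℂ) :
    ∑' a : ℤ, k a * eC ((a:ℂ)^2 * τ / 8 + a * u) = ∑ r : Fin 4, k (r:ℕ) * th (r:ℕ) τ u := by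
  have hs : Summable (fun a : ℤ => k a * eC ((a:ℂ)^2 * τ / 8 + a * u)) := by
    obtain ⟨K, hK, hb⟩ := per_bdd _ hk
    refine Summable.of_norm_bounded ((summable_ee hτ u).mul_left K) (fun a => ?_)
    rw [norm_mul]; gcongr; exact hb a
  rw [tsum_split 4 _ hs]
  refine Finset.sum_congr rfl (fun r _ => ?_)
  unfold th
  rw [← (jt_hasSum _ (UHP_mul hτ 4 (by norm_num))).tsum_eq, ← tsum_mul_left, ← tsum_mul_left]
  congr 1; ext n
  rw [← eC_add]
  congr 1
  · exact (congrArg k (by push_cast; ring)).trans (per_mul k hk ((r:ℕ):ℤ) n)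
  · congr 1; push_cast; ring

def Ph (τ : ℂ) (h : ℤ → ℤ → ℂ) (u v : ℂ) : ℂ := ∑' p, Tm τ h u v p

lemma Ph_hasSum {τ : ℂ} (hτ : UHP τ) {h : ℤ → ℤ → ℂ} (H : HD h) (u v : ℂ) :
    HasSum (Tm τ h u v) (Ph τ h u v) := (Tm_summable hτ h H.h1 H.h2 u v).hasSum

lemma Ph_theta {τ : ℂ} (hτ : UHP τ) {h : ℤ → ℤ → ℂ} (H : HD h) (u v : ℂ) :
    Ph τ h u v = ∑ r : Fin 4, (∑ s : Fin 4, h (r:ℕ) (s:ℕ) * th (s:ℕ) τ v) * th (r:ℕ) τ u := by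
  unfold Ph
  rw [(Tm_summable hτ h H.h1 H.h2 u v).tsum_prod]
  rw [← per_sum hτ (fun a => ∑ s : Fin 4, h a (s:ℕ) * th (s:ℕ) τ v) (fun a => by simp only [H.h1]) u]
  congr 1; ext a
  rw [← per_sum hτ (fun b => h a b) (fun b => H.h2 a b) v, ← tsum_mul_right]
  congr 1; ext b
  unfold Tm; rw [eC_split]; ring

lemma Ph_QP {τ : ℂ} (hτ : UHP τ) {h : ℤ → ℤ → ℂ} (H : HD h) : QP τ (Ph τ h) where
  diff := by
    have e : (fun p : ℂ × ℂ => Ph τ h p.1 p.2) = fun p : ℂ × ℂ =>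
        ∑ r : Fin 4, (∑ s : Fin 4, h (r:ℕ) (s:ℕ) * th (s:ℕ) τ p.2) * th (r:ℕ) τ p.1 := by
      ext p; exact Ph_theta hτ H _ _
    rw [e]
    have d : ∀ r, Differentiable ℂ (th r τ) := fun r => by
      have := (th_diff r).comp (s := Set.univ) (f := fun z : ℂ => (τ, z)) (by fun_prop) (fun p hp => hτ)
      exact differentiableOn_univ.1 this
    refine Differentiable.fun_sum (fun r _ => Differentiable.mul (Differentiable.fun_sum (fun s _ => ?_)) ?_)
    · exact ((d _).comp differentiable_snd).const_mul _
    · exact (d _).comp differentiable_fst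
  per u v := by
    unfold Ph; congr 1; ext p; unfold Tm
    congr 1; exact eC_congr_int p.1 (by ring)
  quasi u v := by
    unfold Ph
    rw [← ((Equiv.subRight (4:ℤ)).prodCongr (Equiv.refl ℤ)).tsum_eq, ← tsum_mul_left]
    congr 1; ext p
    unfold Tm
    simp only [Equiv.prodCongr_apply, Prod.map, Equiv.subRight_apply, Equiv.refl_apply]
    rw [H.sh (a' := p.1) (b' := p.2) (by omega) rfl, mul_left_comm, ← eC_add]
    congr 2; push_cast; ring
  rot u v := by
    have := Tm_rot τ h (Ph_hasSum hτ H v (-u))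
    refine this.unique ?_
    refine ((Ph_hasSum hτ H u v).mul_left (-I)).congr_fun (fun p => ?_)
    show h p.2 (-p.1) * _ = -I * (h p.1 p.2 * _)
    rw [H.rot]; ring

lemma QP.rot' {τ : ℂ} {f : ℂ → ℂ → ℂ} (hf : QP τ f) (u v : ℂ) : f u v = I * f v (-u) := by
  rw [hf.rot]; linear_combination (f u v) * I_sq

lemma QP.perN {τ : ℂ} {f : ℂ → ℂ → ℂ} (hf : QP τ f) (q : ℤ) (u v : ℂ) : f (u + q) v = f u v := by
  induction q using Int.induction_on with
  | zero => simp
  | succ n ih => rw [← ih, ← hf.per (u + ((n:ℤ):ℂ))]; push_cast; ring_nf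
  | pred n ih => rw [← ih, ← hf.per]; push_cast; ring_nf

lemma QP.quasiN {τ : ℂ} {f : ℂ → ℂ → ℂ} (hf : QP τ f) (p : ℤ) (u v : ℂ) :
    f (u + p * τ) v = eC (-(2 * p^2 * τ + 4 * p * u)) * f u v := by
  induction p using Int.induction_on with
  | zero => simp [eC_zero]
  | succ n ih =>
    rw [show u + ((n + 1 : ℤ):ℂ) * τ = u + ((n:ℤ):ℂ) * τ + τ by push_cast; ring, hf.quasi, ih,
      ← mul_assoc, ← eC_add]
    congr 2; push_cast; ring
  | pred n ih =>
    have := hf.quasi (u + ((-n - 1 : ℤ):ℂ) * τ) v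
    rw [show u + ((-n - 1 : ℤ):ℂ) * τ + τ = u + ((-n:ℤ):ℂ) * τ by push_cast; ring, ih] at this
    apply mul_left_cancel₀ (eC_ne (-(2 * τ + 4 * (u + ((-n - 1 : ℤ):ℂ) * τ))))
    rw [← this, ← mul_assoc, ← eC_add]
    congr 2; push_cast; ring

lemma QP.shift {τ : ℂ} {f : ℂ → ℂ → ℂ} (hf : QP τ f) (p q : ℤ) (u v : ℂ) :
    f (u + p * τ + q) v = eC (-(2 * p^2 * τ + 4 * p * u)) * f u v := by
  rw [hf.perN, hf.quasiN]

lemma QP.shift2 {τ : ℂ} {f : ℂ → ℂ → ℂ} (hf : QP τ f) (p q : ℤ) (u v : ℂ) :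
    f u (v + p * τ + q) = eC (-(2 * p^2 * τ + 4 * p * v)) * f u v := by
  rw [hf.rot', hf.shift, hf.rot' u v]; ring

lemma M_det (M : Matrix.SpecialLinearGroup (Fin 2) ℤ) : Ma M * Md M - Mb M * Mc M = 1 := by
  have := M.2
  rw [Matrix.det_fin_two] at this
  unfold Ma Mb Mc Md
  exact_mod_cast this

lemma J_ne (M : Matrix.SpecialLinearGroup (Fin 2) ℤ) {τ : ℂ} (hτ : UHP τ) : Mc M * τ + Md M ≠ 0 := by
  intro h
  have h1 := congrArg Complex.im h
  simp [Mc, Md] at h1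
  unfold UHP at hτ
  rcases h1 with h1 | h1
  · have hc : Mc M = 0 := by simp [Mc, h1]
    rw [hc, zero_mul, zero_add] at h
    have := M_det M
    rw [hc, h] at this; simp at this
  · exact hτ.ne' h1

lemma M_UHP (M : Matrix.SpecialLinearGroup (Fin 2) ℤ) {τ : ℂ} (hτ : UHP τ) :
    UHP ((Ma M * τ + Mb M) / (Mc M * τ + Md M)) := by
  have hJ := J_ne M hτ
  have hd := M.2
  rw [Matrix.det_fin_two] at hd
  have hd' : ((M.1 0 0 : ℤ):ℝ) * (M.1 1 1 : ℤ) - (M.1 0 1 : ℤ) * (M.1 1 0 : ℤ) = 1 := by exact_mod_cast hd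
  have hn : 0 < normSq (Mc M * τ + Md M) := normSq_pos.2 hJ
  unfold UHP at *
  rw [Complex.div_im, ← sub_div]
  apply div_pos _ hn
  simp [Ma, Mb, Mc, Md]
  have : ((M.1 0 0 : ℤ):ℝ) * τ.im * ((M.1 1 0 : ℤ) * τ.re + (M.1 1 1 : ℤ)) -
    ((M.1 0 0 : ℤ) * τ.re + (M.1 0 1 : ℤ)) * ((M.1 1 0 : ℤ) * τ.im) = τ.im := by
    linear_combination τ.im * hd'
  linarith

lemma alg1 {a b c d τ J u : ℂ} (hJ : J ≠ 0) (hd : J = c * τ + d) (det : a * d - b * c = 1) :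
    (u + τ) / J = u / J + d * ((a * τ + b) / J) + -b := by
  field_simp
  rw [hd]
  linear_combination -τ * det

lemma alg2 {a b c d τ J u v : ℂ} (hJ : J ≠ 0) (hd : J = c * τ + d) (det : a * d - b * c = 1) :
    -(2 * c * ((u + τ)^2 + v^2)) / J + -(2 * d^2 * ((a * τ + b) / J) + 4 * d * (u / J)) =
    -(2 * τ + 4 * u) + -(2 * c * (u^2 + v^2)) / J + -2 * b * d := by
  field_simp
  rw [hd]
  linear_combination (-2 * d * τ) * det

lemma alg3 {a b c d τ J u v : ℂ} (hJ : J ≠ 0) (hd : J = c * τ + d) (det : a * d - b * c = 1) :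
    -(2 * c * ((u + 1)^2 + v^2)) / J + -(2 * (-c)^2 * ((a * τ + b) / J) + 4 * (-c) * (u / J)) =
    -(2 * c * (u^2 + v^2)) / J + -2 * c * a := by
  field_simp
  rw [hd]
  linear_combination (2 * c) * det

/-- slash of a `QP` function. -/
lemma QP_slash (k : ℕ) (M : Matrix.SpecialLinearGroup (Fin 2) ℤ) {τ : ℂ} (hτ : UHP τ) {f : ℂ → ℂ → ℂ}
    (hf : QP ((Ma M * τ + Mb M) / (Mc M * τ + Md M)) f) :
    QP τ (fun u v => ((Mc M * τ + Md M)^k)⁻¹ * eC (-(2 * Mc M * (u^2 + v^2)) / (Mc M * τ + Md M)) *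
      f (u / (Mc M * τ + Md M)) (v / (Mc M * τ + Md M))) := by
  have hJ := J_ne M hτ
  have det := M_det M
  refine ⟨?_, ?_, ?_, ?_⟩
  · have := eC_diff
    have h1 := hf.diff.comp (f := fun p : ℂ × ℂ => (p.1 / (Mc M * τ + Md M), p.2 / (Mc M * τ + Md M)))
      (by fun_prop)
    refine Differentiable.mul (by fun_prop) h1
  · intro u v
    have e : (u + 1) / (Mc M * τ + Md M) = u / (Mc M * τ + Md M) +
      ((-(M.1 1 0) : ℤ):ℂ) * ((Ma M * τ + Mb M) / (Mc M * τ + Md M)) + ((M.1 0 0 : ℤ):ℂ) := by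
      change _ = _ + _ + Ma M
      push_cast
      change _ = _ + (-Mc M) * _ + Ma M
      field_simp
      linear_combination -det
    rw [e, hf.shift]
    have : eC (-(2 * Mc M * ((u + 1)^2 + v^2)) / (Mc M * τ + Md M)) *
        eC (-(2 * ((-(M.1 1 0) : ℤ):ℂ)^2 * ((Ma M * τ + Mb M) / (Mc M * τ + Md M)) +
          4 * ((-(M.1 1 0) : ℤ):ℂ) * (u / (Mc M * τ + Md M)))) =
        eC (-(2 * Mc M * (u^2 + v^2)) / (Mc M * τ + Md M)) := by
      rw [← eC_add]
      refine eC_congr_int (-2 * M.1 1 0 * M.1 0 0) ?_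
      push_cast
      change _ = _ + -2 * Mc M * Ma M
      change _ + -(2 * (-Mc M)^2 * _ + 4 * (-Mc M) * _) = _
      exact alg3 hJ rfl det
    linear_combination (((Mc M * τ + Md M)^k)⁻¹ * f (u / (Mc M * τ + Md M)) (v / (Mc M * τ + Md M))) * this
  · intro u v
    have e : (u + τ) / (Mc M * τ + Md M) = u / (Mc M * τ + Md M) +
      ((M.1 1 1 : ℤ):ℂ) * ((Ma M * τ + Mb M) / (Mc M * τ + Md M)) + ((-(M.1 0 1) : ℤ):ℂ) := by
      push_cast
      change _ = _ + Md M * _ + -Mb M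
      exact alg1 hJ rfl det
    rw [e, hf.shift]
    have : eC (-(2 * Mc M * ((u + τ)^2 + v^2)) / (Mc M * τ + Md M)) *
        eC (-(2 * ((M.1 1 1 : ℤ):ℂ)^2 * ((Ma M * τ + Mb M) / (Mc M * τ + Md M)) +
          4 * ((M.1 1 1 : ℤ):ℂ) * (u / (Mc M * τ + Md M)))) =
        eC (-(2 * τ + 4 * u)) * eC (-(2 * Mc M * (u^2 + v^2)) / (Mc M * τ + Md M)) := by
      rw [← eC_add, ← eC_add]
      refine eC_congr_int (-2 * M.1 0 1 * M.1 1 1) ?_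
      push_cast
      change _ = _ + -2 * Mb M * Md M
      change _ + -(2 * (Md M)^2 * _ + 4 * (Md M) * _) = _
      exact alg2 hJ rfl det
    linear_combination (((Mc M * τ + Md M)^k)⁻¹ * f (u / (Mc M * τ + Md M)) (v / (Mc M * τ + Md M))) * this
  · intro u v
    rw [neg_div _ u, hf.rot]
    rw [show v^2 + (-u)^2 = u^2 + v^2 by ring]; ring

def Cr (c : ℕ → ℤ → ℂ) (r : ℤ) (w : ℂ) : ℂ := ∑' n : ℕ, c n r * w ^ n

lemma JF_swap {c : ℕ → ℤ → ℂ} {ψ : ℂ → ℂ → ℂ}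
    (hs : ∀ τ z : ℂ, UHP τ →
        HasSum (fun p : ℕ × ℤ => c p.1 p.2 * eC ((p.1 : ℂ) * τ + (p.2 : ℂ) * z)) (ψ τ z))
    {τ : ℂ} (hτ : UHP τ) (z : ℂ) :
    HasSum (fun p : ℤ × ℕ => (c p.2 p.1 * eC τ ^ p.2) * eC (p.1 * z)) (ψ τ z) := by
  refine ((Equiv.prodComm ℤ ℕ).hasSum_iff.2 (hs τ z hτ)).congr_fun (fun p => ?_)
  simp only [Function.comp, Equiv.prodComm_apply, Prod.fst_swap, Prod.snd_swap]
  rw [eC_add, eC_natmul]; ring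

lemma Cr_summable {c : ℕ → ℤ → ℂ} {ψ : ℂ → ℂ → ℂ}
    (hs : ∀ τ z : ℂ, UHP τ →
        HasSum (fun p : ℕ × ℤ => c p.1 p.2 * eC ((p.1 : ℂ) * τ + (p.2 : ℂ) * z)) (ψ τ z))
    (r : ℤ) (w : ℂ) (hw : ‖w‖ < 1) (h0 : w ≠ 0) : Summable (fun n : ℕ => c n r * w ^ n) := by
  obtain ⟨τ, hτ, rfl⟩ := exists_eC hw h0
  refine ((JF_swap hs hτ 0).summable.prod_factor r).congr (fun n => ?_)
  simp [eC_zero]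

lemma Cr_hasSum {c : ℕ → ℤ → ℂ} {ψ : ℂ → ℂ → ℂ}
    (hs : ∀ τ z : ℂ, UHP τ →
        HasSum (fun p : ℕ × ℤ => c p.1 p.2 * eC ((p.1 : ℂ) * τ + (p.2 : ℂ) * z)) (ψ τ z))
    {τ : ℂ} (hτ : UHP τ) (z : ℂ) :
    HasSum (fun r : ℤ => Cr c r (eC τ) * eC (r * z)) (ψ τ z) :=
  (JF_swap hs hτ z).prod_fiberwise (fun r =>
    (Cr_summable hs r _ (eC_lt_one hτ) (eC_ne _)).hasSum.mul_right _)

lemma Cr_diff {c : ℕ → ℤ → ℂ} {ψ : ℂ → ℂ → ℂ}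
    (hs : ∀ τ z : ℂ, UHP τ →
        HasSum (fun p : ℕ × ℤ => c p.1 p.2 * eC ((p.1 : ℂ) * τ + (p.2 : ℂ) * z)) (ψ τ z))
    (r : ℤ) : DifferentiableOn ℂ (Cr c r) (Metric.ball 0 1) :=
  diff_of_pow (fun n : ℕ => c n r) (fun n => n) (Cr_summable hs r)

lemma Cr_zero (c : ℕ → ℤ → ℂ) (r : ℤ) : Cr c r 0 = c 0 r := by
  unfold Cr
  rw [tsum_eq_single 0]
  · simp
  · intro n hn; simp [hn]

lemma odd_k {k : ℕ} (hk4 : k % 4 = 3) : (-1 : ℂ)^k = -1 :=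
  Odd.neg_one_pow (by rw [Nat.odd_iff]; omega)

lemma JF_odd {k : ℕ} (hk4 : k % 4 = 3) {ψ : ℂ → ℂ → ℂ} (H : IsJF k 4 ψ) {τ : ℂ} (hτ : UHP τ) (z : ℂ) :
    ψ τ (-z) = - ψ τ z := by
  have := H.transf ⟨!![-1, 0; 0, -1], by simp⟩ τ z hτ
  simpa [Ma, Mb, Mc, Md, eC_zero, odd_k hk4, div_neg] using this

lemma Cr_neg {k : ℕ} (hk4 : k % 4 = 3) {c : ℕ → ℤ → ℂ} {ψ : ℂ → ℂ → ℂ} (H : IsJF k 4 ψ)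
    (hs : ∀ τ z : ℂ, UHP τ →
        HasSum (fun p : ℕ × ℤ => c p.1 p.2 * eC ((p.1 : ℂ) * τ + (p.2 : ℂ) * z)) (ψ τ z))
    {τ : ℂ} (hτ : UHP τ) (r : ℤ) : Cr c (-r) (eC τ) = - Cr c r (eC τ) := by
  refine fourier_unique1' (fun r => Cr c (-r) (eC τ)) (fun r => - Cr c r (eC τ)) (fun x => - ψ τ x)
    (fun x => ?_) (fun x => ?_) r
  · rw [← JF_odd hk4 H hτ]
    refine ((Equiv.neg ℤ).hasSum_iff.2 (Cr_hasSum hs hτ (-(x:ℂ)))).congr_fun (fun a => ?_)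
    simp
  · refine (Cr_hasSum hs hτ x).neg.congr_fun (fun a => ?_)
    ring

lemma Cr_shift {k : ℕ} {c : ℕ → ℤ → ℂ} {ψ : ℂ → ℂ → ℂ} (H : IsJF k 4 ψ)
    (hs : ∀ τ z : ℂ, UHP τ →
        HasSum (fun p : ℕ × ℤ => c p.1 p.2 * eC ((p.1 : ℂ) * τ + (p.2 : ℂ) * z)) (ψ τ z))
    {τ : ℂ} (hτ : UHP τ) (r : ℤ) : Cr c (r + 8) (eC τ) = eC ((r + 4) * τ) * Cr c r (eC τ) := by
  refine fourier_unique1' (fun r => Cr c (r + 8) (eC τ)) (fun r => eC ((r + 4) * τ) * Cr c r (eC τ))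
    (fun x => eC (-8 * x) * ψ τ x)
    (fun x => ?_) (fun x => ?_) r
  · refine (((Equiv.addRight (8:ℤ)).hasSum_iff.2 (Cr_hasSum hs hτ x)).mul_left (eC (-8 * x))).congr_fun
      (fun a => ?_)
    simp only [Function.comp, Equiv.coe_addRight]
    rw [mul_left_comm, ← eC_add]; congr 2; push_cast; ring
  · have e := H.ellip 1 0 τ x hτ
    have : eC (-8 * x) * ψ τ x = eC (4 * τ) * ψ τ (x + τ) := by
      have h : ψ τ (x + τ) = eC (-4 * (τ + 2 * x)) * ψ τ x := by simpa using e
      rw [h, ← mul_assoc, ← eC_add]; congr 2; ring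
    rw [this]
    refine ((Cr_hasSum hs hτ (x + τ)).mul_left (eC (4 * τ))).congr_fun (fun a => ?_)
    rw [mul_left_comm, ← eC_add, mul_right_comm, ← eC_add, mul_comm]; congr 2; ring

lemma taylor {f : ℂ → ℂ} (hf : DifferentiableOn ℂ f (Metric.ball 0 1)) (h0 : f 0 = 0) :
    ∃ g : ℕ → ℂ, g 0 = 0 ∧ ∀ w, ‖w‖ < 1 → HasSum (fun n => g n * w ^ n) (f w) := by
  refine ⟨fun n => ((n.factorial : ℂ))⁻¹ * iteratedDeriv n f 0, by simp [h0], fun w hw => ?_⟩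
  have := Complex.hasSum_taylorSeries_on_ball (c := 0) (r := 1) (f := f) (by simpa using hf) (z := w)
    (by simpa using hw)
  refine this.congr_fun (fun n => ?_)
  simp; ring

/-- the theta data for the lift -/
structure LD (c : ℕ → ℤ → ℂ) (FA FB FD : ℂ → ℂ) : Prop where
  dA : DifferentiableOn ℂ FA (Metric.ball 0 1)
  dB : DifferentiableOn ℂ FB (Metric.ball 0 1)
  dD : DifferentiableOn ℂ FD (Metric.ball 0 1)
  zA : FA 0 = 0
  zB : FB 0 = 0
  zD : FD 0 = 0
  e1 : ∀ w, ‖w‖ < 1 → (1 - I) * FA w * tx w + (1 + I) * FB w * ty w = Cr c 1 w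
  e2 : ∀ w, ‖w‖ < 1 → FD w * td w = Cr c 2 w
  e3 : ∀ w, ‖w‖ < 1 → -((1 - I) * FA w * (w * ty w) + (1 + I) * FB w * tx w) = Cr c 3 w

lemma alg4 {x y w p q a b Q : ℂ} (ha : a ≠ 0) (hb : b ≠ 0) (hQ : Q ≠ 0) (e : Q = x^2 - w * y^2) :
    a * ((x * p + y * q) / (a * Q)) * x + b * (-(w * y * p + x * q) / (b * Q)) * y = p := by
  field_simp
  rw [e]; ring

lemma alg5 {x y w p q a b Q : ℂ} (ha : a ≠ 0) (hb : b ≠ 0) (hQ : Q ≠ 0) (e : Q = x^2 - w * y^2) :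
    -(a * ((x * p + y * q) / (a * Q)) * (w * y) + b * (-(w * y * p + x * q) / (b * Q)) * x) = q := by
  field_simp
  rw [e]; ring

lemma LD_exists {c : ℕ → ℤ → ℂ} {ψ : ℂ → ℂ → ℂ} (hc : ∀ (n : ℕ) (r : ℤ), 4 * (n : ℤ) * (4:ℕ) < r ^ 2 → c n r = 0)
    (hs : ∀ τ z : ℂ, UHP τ →
        HasSum (fun p : ℕ × ℤ => c p.1 p.2 * eC ((p.1 : ℂ) * τ + (p.2 : ℂ) * z)) (ψ τ z)) :
    ∃ FA FB FD, LD c FA FB FD := by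
  have d1 := Cr_diff hs 1
  have d2 := Cr_diff hs 2
  have d3 := Cr_diff hs 3
  have z1 : Cr c 1 0 = 0 := by rw [Cr_zero]; exact hc 0 1 (by norm_num)
  have z2 : Cr c 2 0 = 0 := by rw [Cr_zero]; exact hc 0 2 (by norm_num)
  have z3 : Cr c 3 0 = 0 := by rw [Cr_zero]; exact hc 0 3 (by norm_num)
  have hx := tx_diff
  have hy := ty_diff
  have hd := td_diff
  have hw : DifferentiableOn ℂ (fun w : ℂ => w) (Metric.ball 0 1) := differentiableOn_id
  have hI1 := one_sub_I_ne
  have hI2 := one_add_I_ne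
  have D1 : DifferentiableOn ℂ (fun w => tx w^2 - w * ty w^2) (Metric.ball 0 1) :=
    (hx.pow 2).sub (hw.mul (hy.pow 2))
  refine ⟨fun w => (tx w * Cr c 1 w + ty w * Cr c 3 w) / ((1 - I) * (tx w^2 - w * ty w^2)),
    fun w => -(w * ty w * Cr c 1 w + tx w * Cr c 3 w) / ((1 + I) * (tx w^2 - w * ty w^2)),
    fun w => Cr c 2 w / td w, ?_, ?_, ?_, ?_, ?_, ?_, ?_, ?_, ?_⟩
  · exact ((hx.mul d1).add (hy.mul d3)).div (D1.const_mul _)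
      (fun w h => mul_ne_zero hI1 (disc_ne' (by simpa using h)))
  · exact (((hw.mul hy).mul d1).add (hx.mul d3)).neg.div (D1.const_mul _)
      (fun w h => mul_ne_zero hI2 (disc_ne' (by simpa using h)))
  · exact d2.div hd (fun w h => td_ne' (by simpa using h))
  · simp [z1, z3]
  · simp [z1, z3]
  · simp [z2]
  · intro w h
    exact alg4 hI1 hI2 (disc_ne' h) rfl
  · intro w h
    have := td_ne' h
    field_simp
  · intro w h
    exact alg5 hI1 hI2 (disc_ne' h) rfl

lemma tab10 (A B D : ℂ) : tab A B D 1 0 = A := rfl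
lemma tab21 (A B D : ℂ) : tab A B D 2 1 = B := rfl
lemma tab13 (A B D : ℂ) : tab A B D 1 3 = D := rfl

lemma Tmat_lin (A B D x y z : ℂ) (a b : ZMod 4) :
    Tmat (A * x) (B * y) (D * z) a b = A * Tmat x 0 0 a b + B * Tmat 0 y 0 a b + D * Tmat 0 0 z a b := by
  have key : ∀ a b : Fin 4, Tmat (A * x) (B * y) (D * z) a b =
      A * Tmat x 0 0 a b + B * Tmat 0 y 0 a b + D * Tmat 0 0 z a b := by
    intro a b
    fin_cases a <;> fin_cases b <;> simp [Tmat] <;> ring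
  exact key a b

lemma tab_lin (A B D x y z : ℂ) (a b : ℤ) :
    tab (A * x) (B * y) (D * z) a b = A * tab x 0 0 a b + B * tab 0 y 0 a b + D * tab 0 0 z a b :=
  Tmat_lin _ _ _ _ _ _ _ _

lemma tab_zero (a b : ℤ) : tab 0 0 0 a b = 0 := by
  have := tab_lin 0 0 0 0 0 0 a b
  simpa using this

/-- residues of squares. -/
lemma sq_mod (a : ℤ) : (a % 4 = 0 ∧ a^2 % 8 = 0) ∨ (a % 4 = 1 ∧ a^2 % 8 = 1) ∨
    (a % 4 = 2 ∧ a^2 % 8 = 4) ∨ (a % 4 = 3 ∧ a^2 % 8 = 1) := by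
  obtain ⟨q, hq⟩ : ∃ q, q = a / 4 := ⟨_, rfl⟩
  obtain ⟨s, hs⟩ : ∃ s, s = a % 4 := ⟨_, rfl⟩
  have h : a = 4 * q + s := by omega
  have e : a^2 = 8 * (2 * q^2 + q * s) + s^2 := by rw [h]; ring
  have h4 : s = 0 ∨ s = 1 ∨ s = 2 ∨ s = 3 := by omega
  rcases h4 with rfl | rfl | rfl | rfl <;> omega

lemma tab_tbl (A B D : ℂ) : tab A B D 0 0 = 0 ∧ tab A B D 0 1 = I * A ∧ tab A B D 0 2 = 0 ∧ tab A B D 0 3 = -I * A ∧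
    tab A B D 1 0 = A ∧ tab A B D 1 1 = I * D ∧ tab A B D 1 2 = -I * B ∧ tab A B D 1 3 = D ∧
    tab A B D 2 0 = 0 ∧ tab A B D 2 1 = B ∧ tab A B D 2 2 = 0 ∧ tab A B D 2 3 = -B ∧
    tab A B D 3 0 = -A ∧ tab A B D 3 1 = -D ∧ tab A B D 3 2 = I * B ∧ tab A B D 3 3 = -I * D :=
  ⟨rfl, rfl, rfl, rfl, rfl, rfl, rfl, rfl, rfl, rfl, rfl, rfl, rfl, rfl, rfl, rfl⟩

lemma tab_twist (A B D τ : ℂ) (a b : ℤ) :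
    tab A B D a b * eC (-(((a^2 % 8 : ℤ):ℂ) + ((b^2 % 8 : ℤ):ℂ)) * τ / 8) =
      tab (A * eC (-τ/8)) (B * eC (-5*τ/8)) (D * eC (-2*τ/8)) a b := by
  rw [(tab_HD A B D).sh (a' := a % 4) (b' := b % 4) (by omega) (by omega),
    (tab_HD (A * eC (-τ/8)) (B * eC (-5*τ/8)) (D * eC (-2*τ/8))).sh (a' := a % 4) (b' := b % 4)
      (by omega) (by omega)]
  have T1 := tab_tbl A B D
  have T2 := tab_tbl (A * eC (-τ/8)) (B * eC (-5*τ/8)) (D * eC (-2*τ/8))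
  have x1 : eC (-(1 + 0) * τ / 8) = eC (-τ/8) := by ring_nf
  have x2 : eC (-(0 + 1) * τ / 8) = eC (-τ/8) := by ring_nf
  have x3 : eC (-(1 + 4) * τ / 8) = eC (-5*τ/8) := by ring_nf
  have x4 : eC (-(4 + 1) * τ / 8) = eC (-5*τ/8) := by ring_nf
  have x5 : eC (-(1 + 1) * τ / 8) = eC (-2*τ/8) := by ring_nf
  obtain ⟨p1, p2, p3, p4, p5, p6, p7, p8, p9, p10, p11, p12, p13, p14, p15, p16⟩ := T1
  obtain ⟨q1, q2, q3, q4, q5, q6, q7, q8, q9, q10, q11, q12, q13, q14, q15, q16⟩ := T2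
  rcases sq_mod a with ⟨h1, h2⟩ | ⟨h1, h2⟩ | ⟨h1, h2⟩ | ⟨h1, h2⟩ <;>
  rcases sq_mod b with ⟨k1, k2⟩ | ⟨k1, k2⟩ | ⟨k1, k2⟩ | ⟨k1, k2⟩ <;>
  · rw [h2, k2, h1, k1]
    push_cast
    simp only [p1, p2, p3, p4, p5, p6, p7, p8, p9, p10, p11, p12, p13, p14, p15, p16,
      q1, q2, q3, q4, q5, q6, q7, q8, q9, q10, q11, q12, q13, q14, q15, q16, x1, x2, x3, x4, x5]
    try ring

/-- theta coefficients of the lift -/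
def hh (FA FB FD : ℂ → ℂ) (τ : ℂ) : ℤ → ℤ → ℂ :=
  tab (FA (eC τ) * eC (-τ/8)) (FB (eC τ) * eC (-5*τ/8)) (FD (eC τ) * eC (-2*τ/8))

def Lf (FA FB FD : ℂ → ℂ) (τ z₁ z₂ : ℂ) : ℂ := Ph τ (hh FA FB FD τ) ((z₁ + z₂)/2) (I * (z₁ - z₂)/2)

lemma Lf_QP (FA FB FD : ℂ → ℂ) {τ : ℂ} (hτ : UHP τ) : QP τ (Ph τ (hh FA FB FD τ)) :=
  Ph_QP hτ (tab_HD _ _ _)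

lemma Lf_restr {k : ℕ} (hk4 : k % 4 = 3) {c : ℕ → ℤ → ℂ} {ψ : ℂ → ℂ → ℂ} (H : IsJF k 4 ψ)
    (hs : ∀ τ z : ℂ, UHP τ →
        HasSum (fun p : ℕ × ℤ => c p.1 p.2 * eC ((p.1 : ℂ) * τ + (p.2 : ℂ) * z)) (ψ τ z))
    {FA FB FD : ℂ → ℂ} (L : LD c FA FB FD) {τ : ℂ} (hτ : UHP τ) (z : ℂ) :
    Ph τ (hh FA FB FD τ) z (-z) = ψ τ z := by
  have HH : HD (hh FA FB FD τ) := tab_HD _ _ _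
  have hw := eC_lt_one hτ
  have e1 := L.e1 _ hw
  have e2 := L.e2 _ hw
  have e3 := L.e3 _ hw
  have t1 : hh FA FB FD τ 1 0 = FA (eC τ) * eC (-τ/8) := rfl
  have t2 : hh FA FB FD τ 2 1 = FB (eC τ) * eC (-5*τ/8) := rfl
  have t3 : hh FA FB FD τ 1 3 = FD (eC τ) * eC (-2*τ/8) := rfl
  have x1 : eC (-τ/8) * eC (τ/8) = 1 := by rw [← eC_add, ← eC_zero]; congr 1; ring
  have x2 : eC (-5*τ/8) * eC (5*τ/8) = 1 := by rw [← eC_add, ← eC_zero]; congr 1; ring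
  have x3 : eC (-2*τ/8) * eC (τ/4) = 1 := by rw [← eC_add, ← eC_zero]; congr 1; ring
  have x4 : eC (-τ/8) * eC (9*τ/8) = eC τ := by rw [← eC_add]; congr 1; ring
  have key : ∀ r, Rr τ (hh FA FB FD τ) r - Cr c r (eC τ) = 0 := by
    refine Dgen (τ := τ) (fun r => Rr τ (hh FA FB FD τ) r - Cr c r (eC τ)) (fun r => ?_) (fun r => ?_) ?_ ?_ ?_
    · rw [Rr_neg τ HH, Cr_neg hk4 H hs hτ]; ring
    · rw [Rr_shift τ HH, Cr_shift H hs hτ]; ring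
    · rw [Rr_one hτ HH, t1, t2, ← e1]
      linear_combination ((1 - I) * FA (eC τ) * tx (eC τ)) * x1 + ((1 + I) * FB (eC τ) * ty (eC τ)) * x2
    · rw [Rr_two hτ HH, t3, ← e2]
      linear_combination (FD (eC τ) * td (eC τ)) * x3
    · rw [Rr_three hτ HH, t1, t2, ← e3]
      linear_combination (-(1 - I) * FA (eC τ) * ty (eC τ)) * x4 - ((1 + I) * FB (eC τ) * tx (eC τ)) * x2
  have h1 := restr_hasSum hτ HH (Ph_hasSum hτ HH z (-z))
  refine h1.unique ((Cr_hasSum hs hτ z).congr_fun (fun r => ?_))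
  rw [sub_eq_zero.1 (key r)]

lemma Lf_transf1 {k : ℕ} (hk4 : k % 4 = 3) {c : ℕ → ℤ → ℂ} {ψ : ℂ → ℂ → ℂ} (H : IsJF k 4 ψ)
    (hs : ∀ τ z : ℂ, UHP τ →
        HasSum (fun p : ℕ × ℤ => c p.1 p.2 * eC ((p.1 : ℂ) * τ + (p.2 : ℂ) * z)) (ψ τ z))
    {FA FB FD : ℂ → ℂ} (L : LD c FA FB FD) (M : Matrix.SpecialLinearGroup (Fin 2) ℤ)
    {τ : ℂ} (hτ : UHP τ) (u v : ℂ) :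
    Ph ((Ma M * τ + Mb M) / (Mc M * τ + Md M)) (hh FA FB FD ((Ma M * τ + Mb M) / (Mc M * τ + Md M)))
      (u / (Mc M * τ + Md M)) (v / (Mc M * τ + Md M)) =
      (Mc M * τ + Md M)^k * eC (2 * Mc M * (u^2 + v^2) / (Mc M * τ + Md M)) *
        Ph τ (hh FA FB FD τ) u v := by
  have hJ := J_ne M hτ
  have hJk := pow_ne_zero k hJ
  have hM := M_UHP M hτ
  have q := (QP_slash k M hτ (Lf_QP FA FB FD hM)).sub (Lf_QP FA FB FD hτ)
  have := QP_unique hτ q (fun z => ?_) u v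
  · have h := sub_eq_zero.1 this
    rw [← h]
    have e : eC (2 * Mc M * (u^2 + v^2) / (Mc M * τ + Md M)) *
        eC (-(2 * Mc M * (u^2 + v^2)) / (Mc M * τ + Md M)) = 1 := by
      rw [← eC_add, ← eC_zero]; congr 1; ring
    have e' : (Mc M * τ + Md M)^k * ((Mc M * τ + Md M)^k)⁻¹ = 1 := mul_inv_cancel₀ hJk
    generalize Ph _ _ (u / (Mc M * τ + Md M)) (v / (Mc M * τ + Md M)) = X at *
    linear_combination (-X) * e - (X * eC (2 * Mc M * (u^2 + v^2) / (Mc M * τ + Md M)) *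
        eC (-(2 * Mc M * (u^2 + v^2)) / (Mc M * τ + Md M))) * e'
  · rw [neg_div _ z, Lf_restr hk4 H hs L hM, Lf_restr hk4 H hs L hτ, H.transf M τ z hτ]
    have e : eC (-(2 * Mc M * (z^2 + (-z)^2)) / (Mc M * τ + Md M)) *
        eC (((4:ℕ):ℂ) * Mc M * z^2 / (Mc M * τ + Md M)) = 1 := by
      rw [← eC_add, ← eC_zero]; congr 1; push_cast; ring
    have e' : ((Mc M * τ + Md M)^k)⁻¹ * (Mc M * τ + Md M)^k = 1 := inv_mul_cancel₀ hJk
    linear_combination (ψ τ z) * e + (ψ τ z * eC (-(2 * Mc M * (z^2 + (-z)^2)) / (Mc M * τ + Md M)) *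
        eC (((4:ℕ):ℂ) * Mc M * z^2 / (Mc M * τ + Md M))) * e'

lemma Lf_unit (FA FB FD : ℂ → ℂ) {k : ℕ} (hk4 : k % 4 = 3) {τ : ℂ} (hτ : UHP τ) (ε z₁ z₂ : ℂ)
    (hε : ε ∈ ({1, -1, Complex.I, -Complex.I} : Set ℂ)) :
    Lf FA FB FD τ (ε * z₁) ((starRingEnd ℂ) ε * z₂) = ε^k * Lf FA FB FD τ z₁ z₂ := by
  have r : ∀ z₁ z₂, Lf FA FB FD τ (I * z₁) (-I * z₂) = -I * Lf FA FB FD τ z₁ z₂ := by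
    intro z₁ z₂
    unfold Lf
    rw [← (Lf_QP FA FB FD hτ).rot]
    congr 1
    · ring
    · linear_combination ((z₁ + z₂)/2) * I_sq
  have r2 : ∀ z₁ z₂, Lf FA FB FD τ (-z₁) (-z₂) = - Lf FA FB FD τ z₁ z₂ := by
    intro z₁ z₂
    have h := r (I * z₁) (-I * z₂)
    rw [r z₁ z₂] at h
    rw [show I * (I * z₁) = -z₁ by linear_combination z₁ * I_sq,
      show -I * (-I * z₂) = -z₂ by linear_combination z₂ * I_sq] at h
    rw [h]; linear_combination (Lf FA FB FD τ z₁ z₂) * I_sq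
  rcases hε with rfl | rfl | rfl | rfl
  · simp
  · have := r2 z₁ z₂
    simp [odd_k hk4, this]
  · rw [Ik3 hk4, conj_I]; exact r _ _
  · rw [neg_pow, odd_k hk4, Ik3 hk4, map_neg, conj_I]
    have := r2 (I * z₁) (-I * z₂)
    rw [r] at this
    rw [neg_mul, neg_neg]
    rw [neg_mul I z₂, neg_neg] at this
    rw [this]; ring

lemma Lf_holo {c : ℕ → ℤ → ℂ} {FA FB FD : ℂ → ℂ} (L : LD c FA FB FD) :
    DifferentiableOn ℂ (fun p : ℂ × ℂ × ℂ => Lf FA FB FD p.1 p.2.1 p.2.2) {p | UHP p.1} := by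
  have ed := eC_diff
  have cF : ∀ F : ℂ → ℂ, DifferentiableOn ℂ F (Metric.ball 0 1) →
      DifferentiableOn ℂ (fun p : ℂ × ℂ × ℂ => F (eC p.1)) {p | UHP p.1} := fun F hF =>
    hF.comp (f := fun p : ℂ × ℂ × ℂ => eC p.1) (by fun_prop) (fun p hp => by
      have := eC_lt_one hp
      simpa using this)
  have hA : DifferentiableOn ℂ (fun p : ℂ × ℂ × ℂ => FA (eC p.1) * eC (-p.1/8)) {p | UHP p.1} :=
    (cF _ L.dA).mul (by fun_prop)
  have hB : DifferentiableOn ℂ (fun p : ℂ × ℂ × ℂ => FB (eC p.1) * eC (-5*p.1/8)) {p | UHP p.1} :=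
    (cF _ L.dB).mul (by fun_prop)
  have hD : DifferentiableOn ℂ (fun p : ℂ × ℂ × ℂ => FD (eC p.1) * eC (-2*p.1/8)) {p | UHP p.1} :=
    (cF _ L.dD).mul (by fun_prop)
  have hT : ∀ a b : ℤ, DifferentiableOn ℂ (fun p : ℂ × ℂ × ℂ => hh FA FB FD p.1 a b) {p | UHP p.1} := by
    intro a b
    have e : (fun p : ℂ × ℂ × ℂ => hh FA FB FD p.1 a b) = fun p : ℂ × ℂ × ℂ =>
        (FA (eC p.1) * eC (-p.1/8)) * tab 1 0 0 a b + (FB (eC p.1) * eC (-5*p.1/8)) * tab 0 1 0 a b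
        + (FD (eC p.1) * eC (-2*p.1/8)) * tab 0 0 1 a b := by
      ext p
      rw [← tab_lin]; simp only [mul_one]; rfl
    rw [e]
    exact ((hA.mul_const _).add (hB.mul_const _)).add (hD.mul_const _)
  have hu : ∀ r : ℕ, DifferentiableOn ℂ (fun p : ℂ × ℂ × ℂ => th r p.1 ((p.2.1 + p.2.2)/2)) {p | UHP p.1} :=
    fun r => (th_diff r).comp (f := fun p : ℂ × ℂ × ℂ => (p.1, (p.2.1 + p.2.2)/2)) (by fun_prop) (fun p hp => hp)
  have hv : ∀ r : ℕ, DifferentiableOn ℂ (fun p : ℂ × ℂ × ℂ => th r p.1 (I * (p.2.1 - p.2.2)/2)) {p | UHP p.1} :=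
    fun r => (th_diff r).comp (f := fun p : ℂ × ℂ × ℂ => (p.1, I * (p.2.1 - p.2.2)/2)) (by fun_prop) (fun p hp => hp)
  have := DifferentiableOn.fun_sum (u := Finset.univ) (𝕜 := ℂ) (s := {p : ℂ × ℂ × ℂ | UHP p.1})
    (A := fun (r : Fin 4) (p : ℂ × ℂ × ℂ) => (∑ s : Fin 4, hh FA FB FD p.1 ((r:ℕ):ℤ) ((s:ℕ):ℤ) *
      th (s:ℕ) p.1 (I * (p.2.1 - p.2.2)/2)) * th (r:ℕ) p.1 ((p.2.1 + p.2.2)/2))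
    (fun r _ => (DifferentiableOn.fun_sum (fun s _ => (hT _ _).mul (hv _))).mul (hu _))
  refine this.congr (fun p hp => ?_)
  exact Ph_theta hp (tab_HD _ _ _) _ _

lemma Lf_ellip (FA FB FD : ℂ → ℂ) (p q u v : ℤ) (τ z₁ z₂ : ℂ) (hτ : UHP τ) :
      Lf FA FB FD τ (z₁ + ((p : ℂ) + (q : ℂ) * Complex.I) * τ + ((u : ℂ) + (v : ℂ) * Complex.I))
          (z₂ + ((p : ℂ) - (q : ℂ) * Complex.I) * τ + ((u : ℂ) - (v : ℂ) * Complex.I))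
      = eC (-((2:ℕ) : ℂ) * (((p : ℂ) ^ 2 + (q : ℂ) ^ 2) * τ
          + ((p : ℂ) - (q : ℂ) * Complex.I) * z₁
          + ((p : ℂ) + (q : ℂ) * Complex.I) * z₂)) * Lf FA FB FD τ z₁ z₂ := by
  have Q := Lf_QP FA FB FD hτ
  unfold Lf
  have e1 : (z₁ + ((p : ℂ) + (q : ℂ) * Complex.I) * τ + ((u : ℂ) + (v : ℂ) * Complex.I) +
      (z₂ + ((p : ℂ) - (q : ℂ) * Complex.I) * τ + ((u : ℂ) - (v : ℂ) * Complex.I)))/2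
      = (z₁ + z₂)/2 + p * τ + u := by ring
  have e2 : I * (z₁ + ((p : ℂ) + (q : ℂ) * Complex.I) * τ + ((u : ℂ) + (v : ℂ) * Complex.I) -
      (z₂ + ((p : ℂ) - (q : ℂ) * Complex.I) * τ + ((u : ℂ) - (v : ℂ) * Complex.I)))/2
      = I * (z₁ - z₂)/2 + ((-q : ℤ):ℂ) * τ + ((-v : ℤ):ℂ) := by
    push_cast; linear_combination ((q:ℂ) * τ + v) * I_sq
  rw [e1, e2, Q.shift, Q.shift2, ← mul_assoc, ← eC_add]
  congr 2
  push_cast; ring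

lemma hs_mul {X Y : Type} {f : X → ℂ} {g : Y → ℂ} {s t : ℂ} (hf : HasSum f s) (hg : HasSum g t) :
    HasSum (fun p : X × Y => f p.1 * g p.2) (s * t) :=
  hf.mul hg (summable_mul_of_summable_norm hf.summable.norm hg.summable.norm)

lemma hs_aux (g : ℕ → ℂ) (w s : ℂ) (T : ℤ × ℤ → ℂ) (P : ℂ) (hg : HasSum (fun n => g n * w ^ n) s) (hT : HasSum T P) :
    HasSum (fun p : ℕ × ℤ × ℤ => (g p.1 * w ^ p.1) * T p.2) (s * P) :=
  hs_mul (X := ℕ) (Y := ℤ × ℤ) (f := fun n => g n * w ^ n) (g := T) hg hT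

lemma S_aux {τ : ℂ} (hτ : UHP τ) (u v x y z : ℂ) (g : ℕ → ℂ) (s : ℂ) (hg : HasSum (fun n => g n * eC τ ^ n) s) :
    HasSum (fun p : ℕ × ℤ × ℤ => (g p.1 * eC τ ^ p.1) * Tm τ (tab x y z) u v p.2)
      (s * Ph τ (tab x y z) u v) := by
  have hT := Ph_hasSum hτ (tab_HD x y z) u v
  exact hs_aux g (eC τ) s _ _ hg hT

def Ee (a : ℤ) : ℕ := (a^2/8).toNat

lemma Ee_eq (a : ℤ) : a^2 = 8 * (Ee a : ℤ) + a^2 % 8 := by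
  unfold Ee
  have := sq_nonneg a
  omega

lemma Lf_fourier {c : ℕ → ℤ → ℂ} {FA FB FD : ℂ → ℂ} (L : LD c FA FB FD) :
    ∃ c : ℕ → ℤ → ℤ → ℂ,
      (∀ (n : ℕ) (a b : ℤ), 4 * (n : ℤ) * (2:ℕ) < a ^ 2 + b ^ 2 → c n a b = 0) ∧
      ∀ τ z₁ z₂ : ℂ, UHP τ →
        HasSum (fun p : ℕ × ℤ × ℤ => c p.1 p.2.1 p.2.2 *
          eC ((p.1 : ℂ) * τ + (((p.2.1 : ℂ) + (p.2.2 : ℂ) * Complex.I) / 2) * z₁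
            + (((p.2.1 : ℂ) - (p.2.2 : ℂ) * Complex.I) / 2) * z₂)) (Lf FA FB FD τ z₁ z₂) := by
  obtain ⟨gA, gA0, hA⟩ := taylor L.dA L.zA
  obtain ⟨gB, gB0, hB⟩ := taylor L.dB L.zB
  obtain ⟨gD, gD0, hD⟩ := taylor L.dD L.zD
  refine ⟨fun N a b => if Ee a + Ee b ≤ N then
    tab (gA (N - (Ee a + Ee b))) (gB (N - (Ee a + Ee b))) (gD (N - (Ee a + Ee b))) a b else 0, ?_, ?_⟩
  · intro N a b h
    simp only
    split_ifs with hN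
    · have : N - (Ee a + Ee b) = 0 := by
        have h1 := Ee_eq a
        have h2 := Ee_eq b
        have h3 := sq_mod a
        have h4 := sq_mod b
        push_cast at h
        omega
      rw [this, gA0, gB0, gD0, tab_zero]
    · rfl
  · intro τ z₁ z₂ hτ
    have hw := eC_lt_one hτ
    let ι : ℕ × ℤ × ℤ → ℕ × ℤ × ℤ := fun p => (p.1 + (Ee p.2.1 + Ee p.2.2), p.2.1, p.2.2)
    have hι : Function.Injective ι := by
      rintro ⟨n, a, b⟩ ⟨n', a', b'⟩ h
      simp only [ι, Prod.mk.injEq] at h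
      obtain ⟨h1, rfl, rfl⟩ := h
      simp at h1; simp [h1]
    rw [← hι.hasSum_iff]
    · have S := S_aux hτ ((z₁ + z₂)/2) (I * (z₁ - z₂)/2)
      have T := ((S (eC (-τ/8)) 0 0 _ _ (hA _ hw)).add (S 0 (eC (-5*τ/8)) 0 _ _ (hB _ hw))).add
        (S 0 0 (eC (-2*τ/8)) _ _ (hD _ hw))
      have P : ∀ x y z, HasSum (Tm τ (tab x y z) ((z₁ + z₂)/2) (I * (z₁ - z₂)/2))
          (Ph τ (tab x y z) ((z₁ + z₂)/2) (I * (z₁ - z₂)/2)) :=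
        fun x y z => Ph_hasSum hτ (tab_HD x y z) ((z₁ + z₂)/2) (I * (z₁ - z₂)/2)
      have eq : Lf FA FB FD τ z₁ z₂ = FA (eC τ) * Ph τ (tab (eC (-τ / 8)) 0 0) ((z₁ + z₂) / 2) (I * (z₁ - z₂) / 2) +
          FB (eC τ) * Ph τ (tab 0 (eC (-5 * τ / 8)) 0) ((z₁ + z₂) / 2) (I * (z₁ - z₂) / 2) +
          FD (eC τ) * Ph τ (tab 0 0 (eC (-2 * τ / 8))) ((z₁ + z₂) / 2) (I * (z₁ - z₂) / 2) := by
        refine (Ph_hasSum hτ (tab_HD (FA (eC τ) * eC (-τ/8)) (FB (eC τ) * eC (-5*τ/8)) (FD (eC τ) * eC (-2*τ/8)))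
          ((z₁ + z₂)/2) (I * (z₁ - z₂)/2)).unique
          (((((P (eC (-τ/8)) 0 0).mul_left (FA (eC τ))).add ((P 0 (eC (-5*τ/8)) 0).mul_left (FB (eC τ)))).add
            ((P 0 0 (eC (-2*τ/8))).mul_left (FD (eC τ)))).congr_fun (fun p => ?_))
        unfold Tm
        rw [tab_lin]; ring
      rw [eq]
      refine T.congr_fun (fun p => ?_)
      obtain ⟨n, a, b⟩ := p
      simp only [Function.comp, ι, Tm]
      rw [if_pos (by omega), Nat.add_sub_cancel]
      have tw := tab_twist (gA n) (gB n) (gD n) τ a b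
      rw [tab_lin] at tw
      have ha : ((a:ℂ))^2 = 8 * (Ee a : ℂ) + ((a^2 % 8 : ℤ) : ℂ) := by exact_mod_cast congrArg (Int.cast (R := ℂ)) (Ee_eq a)
      have hb : ((b:ℂ))^2 = 8 * (Ee b : ℂ) + ((b^2 % 8 : ℤ) : ℂ) := by exact_mod_cast congrArg (Int.cast (R := ℂ)) (Ee_eq b)
      have ex : eC (((n + (Ee a + Ee b) : ℕ) : ℂ) * τ + (((a : ℂ) + (b : ℂ) * Complex.I) / 2) * z₁
            + (((a : ℂ) - (b : ℂ) * Complex.I) / 2) * z₂) =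
          eC τ ^ n * eC (-(((a^2 % 8 : ℤ):ℂ) + ((b^2 % 8 : ℤ):ℂ)) * τ / 8) *
          eC (((a:ℂ)^2 + (b:ℂ)^2) * τ / 8 + a * ((z₁ + z₂)/2) + b * (I * (z₁ - z₂)/2)) := by
        rw [← eC_natmul, ← eC_add, ← eC_add]
        congr 1
        push_cast
        linear_combination (-τ/8) * ha + (-τ/8) * hb
      rw [ex]
      linear_combination (eC τ ^ n *
        eC (((a:ℂ)^2 + (b:ℂ)^2) * τ / 8 + a * ((z₁ + z₂)/2) + b * (I * (z₁ - z₂)/2))) * tw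
    · rintro ⟨N, a, b⟩ h
      simp only
      rw [if_neg, zero_mul]
      intro hN
      exact h ⟨(N - (Ee a + Ee b), a, b), by simp only [ι]; rw [Nat.sub_add_cancel hN]⟩

lemma part3 {k : ℕ} (hk4 : k % 4 = 3) {ψ : ℂ → ℂ → ℂ} (H : IsJF k 4 ψ) :
      ∃ φ : ℂ → ℂ → ℂ → ℂ, IsHJF k 2 φ ∧
        ∀ τ z : ℂ, UHP τ → φ τ ((1 + Complex.I) * z) ((1 - Complex.I) * z) = ψ τ z := by
  obtain ⟨c, hc, hs⟩ := H.fourier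
  obtain ⟨FA, FB, FD, L⟩ := LD_exists hc hs
  refine ⟨Lf FA FB FD, ⟨Lf_holo L, ?_, fun p q u v τ z₁ z₂ hτ => Lf_ellip FA FB FD p q u v τ z₁ z₂ hτ,
    Lf_fourier L⟩, ?_⟩
  · intro ε hε M τ z₁ z₂ hτ
    have := Lf_unit FA FB FD hk4 (M_UHP M hτ) ε (z₁ / (Mc M * τ + Md M)) (z₂ / (Mc M * τ + Md M)) hε
    rw [mul_div_assoc, mul_div_assoc, this]
    unfold Lf
    have t := Lf_transf1 hk4 H hs L M hτ ((z₁ + z₂)/2) (I * (z₁ - z₂)/2)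
    rw [show (z₁ / (Mc M * τ + Md M) + z₂ / (Mc M * τ + Md M))/2 = (z₁ + z₂)/2 / (Mc M * τ + Md M) by ring,
      show I * (z₁ / (Mc M * τ + Md M) - z₂ / (Mc M * τ + Md M))/2 = I * (z₁ - z₂)/2 / (Mc M * τ + Md M) by ring,
      t, show 2 * Mc M * (((z₁ + z₂)/2)^2 + (I * (z₁ - z₂)/2)^2) = ((2:ℕ):ℂ) * Mc M * z₁ * z₂ by
        push_cast; linear_combination (Mc M * (z₁ - z₂)^2/2) * I_sq]
    ring
  · intro τ z hτ
    rw [← Lf_restr hk4 H hs L hτ z]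
    unfold Lf
    congr 1
    · ring
    · linear_combination z * I_sq

/-- for `k ≡ 3 (mod 4)`, the restriction map
`π_{1+i} : J_{k,2}(O_K) → J_{k,4}` is an isomorphism of ℂ-vector spaces. -/
theorem stmt10 (k : ℕ) (hk : 0 < k) (hk4 : k % 4 = 3) :
    (∀ φ : ℂ → ℂ → ℂ → ℂ, IsHJF k 2 φ →
      IsJF k 4 (fun τ z => φ τ ((1 + Complex.I) * z) ((1 - Complex.I) * z))) ∧
    (∀ φ φ' : ℂ → ℂ → ℂ → ℂ, IsHJF k 2 φ → IsHJF k 2 φ' →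
      (∀ τ z : ℂ, UHP τ →
        φ τ ((1 + Complex.I) * z) ((1 - Complex.I) * z)
          = φ' τ ((1 + Complex.I) * z) ((1 - Complex.I) * z)) →
      ∀ τ z₁ z₂ : ℂ, UHP τ → φ τ z₁ z₂ = φ' τ z₁ z₂) ∧
    (∀ ψ : ℂ → ℂ → ℂ, IsJF k 4 ψ →
      ∃ φ : ℂ → ℂ → ℂ → ℂ, IsHJF k 2 φ ∧
        ∀ τ z : ℂ, UHP τ → φ τ ((1 + Complex.I) * z) ((1 - Complex.I) * z) = ψ τ z) := by
  exact ⟨fun φ H => rest_JF k H, fun φ φ' H H' h τ z₁ z₂ hτ => part2 hk4 H H' h τ z₁ z₂ hτ,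
    fun ψ H => part3 hk4 H⟩
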